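/- arXiv:2310.01872 — 5 statements merged into one kernel-verified Lean document; each statement's English description precedes it below -/
import Mathlib

section
/- Let q be a prime power with prime characteristic p, and let F_q be the field with q elements. For every integer n ≥ 1, the quantity Σ_{a ∈ F_p, a ≠ 0} |S_a(n)| − (p−1)·|S_0(n)| equals 0 if p does not divide n, and equals Σ_{a ∈ F_p, a ≠ 0} |S_a(n/p)| if p divides n. -/
open Polynomial

/-- The trace of a monic irreducible polynomial `f = xⁿ + a_{n-1}x^{n-1} + … + a₀`
over a finite field of characteristic `p`: `Tr(f) = -Tr_{q/p}(a_{n-1})`. -/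
noncomputable def polyTrace (F : Type*) [Field F] [Fintype F] (p : ℕ) [CharP F p]
    (f : F[X]) : ZMod p :=
  letI : Algebra (ZMod p) F := ZMod.algebra F p
  Neg.neg (Algebra.trace (ZMod p) F (f.coeff (f.natDegree - 1)))

/-- `S_a(n)`: the set of monic irreducible polynomials of degree `n` over `F_q`
with trace `a ∈ F_p`. -/
def traceSet (F : Type*) [Field F] [Fintype F] (p : ℕ) [CharP F p]
    (a : ZMod p) (n : ℕ) : Set F[X] :=
  {f : F[X] | f.Monic ∧ Irreducible f ∧ f.natDegree = n ∧ polyTrace F p f = a}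


section helpers
variable (F : Type*) [Field F] [Fintype F] (p : ℕ) [Fact p.Prime] [CharP F p]

def irrSet (F : Type*) [Field F] (P : F[X] → Prop) (d : ℕ) : Set F[X] :=
  {f : F[X] | f.Monic ∧ Irreducible f ∧ f.natDegree = d ∧ P f}

lemma splits_ext (n : ℕ) [NeZero n] (f : F[X]) (hi : Irreducible f)
    (hd : f.natDegree ∣ n) :
    (f.map (algebraMap F (FiniteField.Extension F p n))).Splits := by
  have h1 : f ∣ X ^ (Nat.card F) ^ n - X :=
    hi.natDegree_dvd_iff_dvd_X_pow_card_pow_sub_X.1 hd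
  have h2 := (inferInstance : IsSplittingField F (FiniteField.Extension F p n)
    (X ^ Nat.card F ^ n - X)).splits
  refine Splits.of_dvd h2 ?_ (Polynomial.map_dvd _ h1)
  exact map_ne_zero (FiniteField.X_pow_card_pow_sub_X_ne_zero _ (NeZero.ne n) Finite.one_lt_card)

lemma exists_minpoly_ext (n : ℕ) [NeZero n] (f : F[X]) (hm : f.Monic) (hi : Irreducible f)
    (hd : f.natDegree ∣ n) :
    ∃ x : FiniteField.Extension F p n, minpoly F x = f := by
  obtain ⟨x, hx⟩ := (splits_ext F p n f hi hd).exists_eval_eq_zero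
    (by rw [degree_map]; exact hi.degree_pos.ne')
  refine ⟨x, (minpoly.eq_of_irreducible_of_monic hi ?_ hm).symm⟩
  rwa [eval_map_algebraMap] at hx

lemma irrSet_finite (P : F[X] → Prop) (n : ℕ) (hn : n ≠ 0) : (irrSet F P n).Finite := by
  haveI : NeZero n := ⟨hn⟩
  haveI : CharP F (ringChar F) := inferInstance
  haveI : Fact (ringChar F).Prime := ⟨CharP.char_is_prime F _⟩
  refine (Set.finite_range (fun x : FiniteField.Extension F (ringChar F) n => minpoly F x)).subset ?_
  rintro f ⟨hm, hi, hd, -⟩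
  exact exists_minpoly_ext F _ n f hm hi (hd ▸ dvd_rfl)

lemma card_fiber_minpoly (n : ℕ) [NeZero n] (f : F[X]) (hm : f.Monic) (hi : Irreducible f)
    (hd : f.natDegree ∣ n) :
    Nat.card {x : FiniteField.Extension F p n // minpoly F x = f} = f.natDegree := by
  have hs : f.Separable := PerfectField.separable_of_irreducible hi
  have h := card_rootSet_eq_natDegree hs (splits_ext F p n f hi hd)
  rw [← h, ← Nat.card_eq_fintype_card]
  refine Nat.card_congr (Equiv.subtypeEquivRight fun x => ?_)
  rw [mem_rootSet_of_ne hi.ne_zero]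
  constructor
  · rintro rfl; exact minpoly.aeval _ _
  · intro hx; exact (minpoly.eq_of_irreducible_of_monic hi hx hm).symm

open Classical in
lemma card_ext_pred (n : ℕ) [NeZero n] (P : F[X] → Prop) :
    Nat.card {x : FiniteField.Extension F p n // P (minpoly F x)} =
      ∑ d ∈ n.divisors, d * (irrSet F P d).ncard := by
  haveI := Fintype.ofFinite (FiniteField.Extension F p n)
  have hdeg : ∀ x : FiniteField.Extension F p n, (minpoly F x).natDegree ∣ n := by
    intro x
    have := minpoly.degree_dvd (K := F) (x := x) (Algebra.IsIntegral.isIntegral x)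
    rwa [FiniteField.finrank_extension] at this
  have hmon : ∀ x : FiniteField.Extension F p n, (minpoly F x).Monic := fun x =>
    minpoly.monic (Algebra.IsIntegral.isIntegral x)
  have hirr : ∀ x : FiniteField.Extension F p n, Irreducible (minpoly F x) := fun x =>
    minpoly.irreducible (Algebra.IsIntegral.isIntegral x)
  set A : Finset (FiniteField.Extension F p n) := Finset.univ.filter (fun x => P (minpoly F x))
    with hA
  set S : Finset F[X] := A.image (minpoly F) with hS
  have hSmem : ∀ f ∈ S, f.Monic ∧ Irreducible f ∧ f.natDegree ∣ n ∧ P f := by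
    intro f hf
    obtain ⟨x, hx, rfl⟩ := Finset.mem_image.1 hf
    exact ⟨hmon x, hirr x, hdeg x, (Finset.mem_filter.1 hx).2⟩
  have h0 : Nat.card {x : FiniteField.Extension F p n // P (minpoly F x)} = A.card := by
    rw [Nat.card_eq_fintype_card, Fintype.card_subtype]
  have h1 : A.card = ∑ f ∈ S, f.natDegree := by
    rw [Finset.card_eq_sum_card_fiberwise (f := minpoly F) (t := S)
      (fun x hx => Finset.mem_image_of_mem _ hx)]
    refine Finset.sum_congr rfl fun f hf => ?_
    obtain ⟨hm, hi, hd, hP⟩ := hSmem f hf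
    rw [← card_fiber_minpoly F p n f hm hi hd, Nat.card_eq_fintype_card, Fintype.card_subtype]
    congr 1
    ext x
    simp only [hA, Finset.mem_filter, Finset.mem_univ, true_and]
    constructor
    · exact fun h => h.2
    · rintro rfl; exact ⟨hP, rfl⟩
  rw [h0, h1, ← Finset.sum_fiberwise_of_maps_to (g := natDegree) (t := n.divisors)
    (fun f hf => Nat.mem_divisors.2 ⟨(hSmem f hf).2.2.1, NeZero.ne n⟩)]
  refine Finset.sum_congr rfl fun d hd => ?_
  have hset : irrSet F P d = ((S.filter (fun f => f.natDegree = d) : Finset F[X]) : Set F[X]) := by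
    ext f
    simp only [irrSet, Set.mem_ofPred_eq, Finset.coe_filter]
    constructor
    · rintro ⟨hm, hi, hfd, hP⟩
      refine ⟨?_, hfd⟩
      obtain ⟨x, rfl⟩ := exists_minpoly_ext F p n f hm hi (hfd ▸ Nat.dvd_of_mem_divisors hd)
      exact Finset.mem_image_of_mem _ (Finset.mem_filter.2 ⟨Finset.mem_univ _, hP⟩)
    · rintro ⟨hf, hfd⟩
      obtain ⟨hm, hi, -, hP⟩ := hSmem f hf
      exact ⟨hm, hi, hfd, hP⟩
  rw [hset, Set.ncard_coe_finset, Finset.sum_congr rfl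
    (fun f hf => (Finset.mem_filter.1 hf).2), Finset.sum_const, smul_eq_mul, mul_comm]

noncomputable def absTr (n : ℕ) [NeZero n] (x : FiniteField.Extension F p n) : ZMod p :=
  letI : Algebra (ZMod p) F := ZMod.algebra F p
  Algebra.trace (ZMod p) F (Algebra.trace F (FiniteField.Extension F p n) x)

lemma absTr_eq (n : ℕ) [NeZero n] (x : FiniteField.Extension F p n) :
    absTr F p n x = (n / (minpoly F x).natDegree : ℕ) * polyTrace F p (minpoly F x) := by
  letI : Algebra (ZMod p) F := ZMod.algebra F p
  have hx : IsIntegral F x := Algebra.IsIntegral.isIntegral x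
  have hpos := minpoly.natDegree_pos hx
  unfold absTr polyTrace
  have h2 := IntermediateField.adjoin.finrank hx
  have h3 := Module.finrank_mul_finrank F (IntermediateField.adjoin F {x})
    (FiniteField.Extension F p n)
  rw [FiniteField.finrank_extension, h2] at h3
  have h4 : Module.finrank (IntermediateField.adjoin F {x}) (FiniteField.Extension F p n)
      = n / (minpoly F x).natDegree := by
    exact (Nat.div_eq_of_eq_mul_right hpos h3.symm).symm
  rw [trace_eq_finrank_mul_minpoly_nextCoeff F x, h4, nextCoeff_of_natDegree_pos hpos]
  rw [← nsmul_eq_mul, map_nsmul, map_neg, nsmul_eq_mul]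

lemma card_absTr (n : ℕ) [NeZero n] :
    p * Nat.card {x : FiniteField.Extension F p n // absTr F p n x ≠ 0} + Nat.card F ^ n
      = p * Nat.card F ^ n := by
  letI : Algebra (ZMod p) F := ZMod.algebra F p
  let g : FiniteField.Extension F p n →+ ZMod p :=
    (Algebra.trace (ZMod p) F).toAddMonoidHom.comp
      (Algebra.trace F (FiniteField.Extension F p n)).toAddMonoidHom
  have hg : ∀ x, g x = absTr F p n x := fun x => rfl
  have hsurj : Function.Surjective g :=
    (Algebra.trace_surjective (ZMod p) F).comp
      (Algebra.trace_surjective F (FiniteField.Extension F p n))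
  have h1 := g.ker.card_mul_index
  rw [AddSubgroup.index_ker, AddMonoidHom.range_eq_top.2 hsurj, FiniteField.natCard_extension,
    AddSubgroup.card_top, Nat.card_zmod] at h1
  classical
  have h2 : Nat.card g.ker + Nat.card {x : FiniteField.Extension F p n // absTr F p n x ≠ 0}
      = Nat.card F ^ n := by
    rw [← FiniteField.natCard_extension F p n, ← Nat.card_sum]
    exact Nat.card_congr (Equiv.sumCompl (fun x => absTr F p n x = 0))
  nlinarith

lemma sum_all (n : ℕ) (hn : n ≠ 0) :
    ∑ d ∈ n.divisors, d * (irrSet F (fun _ => True) d).ncard = Nat.card F ^ n := by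
  haveI : NeZero n := ⟨hn⟩
  haveI : CharP F (ringChar F) := inferInstance
  haveI : Fact (ringChar F).Prime := ⟨CharP.char_is_prime F _⟩
  rw [← card_ext_pred F (ringChar F) n, ← FiniteField.natCard_extension F (ringChar F) n]
  exact Nat.card_congr (Equiv.subtypeUnivEquiv fun _ => trivial)

lemma sum_nonzero (n : ℕ) (hn : n ≠ 0) :
    p * (∑ d ∈ n.divisors with ¬ p ∣ n / d, d * (irrSet F (fun f => polyTrace F p f ≠ 0) d).ncard)
      + Nat.card F ^ n = p * Nat.card F ^ n := by
  haveI : NeZero n := ⟨hn⟩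
  rw [← card_absTr F p n]
  congr 2
  have h : ∀ x : FiniteField.Extension F p n, absTr F p n x ≠ 0 ↔
      (¬ p ∣ n / (minpoly F x).natDegree ∧ polyTrace F p (minpoly F x) ≠ 0) := by
    intro x
    rw [absTr_eq, mul_ne_zero_iff, Ne, ZMod.natCast_eq_zero_iff]
  rw [Nat.card_congr (Equiv.subtypeEquivRight h), card_ext_pred F p n
    (fun f => ¬ p ∣ n / f.natDegree ∧ polyTrace F p f ≠ 0), Finset.sum_filter]
  refine Finset.sum_congr rfl fun d hd => ?_
  by_cases hp : ¬ p ∣ n / d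
  · rw [if_pos hp]
    congr 2
    ext f
    simp only [irrSet, Set.mem_ofPred_eq]
    constructor
    · rintro ⟨a, b, rfl, c⟩; exact ⟨a, b, rfl, hp, c⟩
    · rintro ⟨a, b, rfl, -, c⟩; exact ⟨a, b, rfl, c⟩
  · have : irrSet F (fun f => ¬ p ∣ n / f.natDegree ∧ polyTrace F p f ≠ 0) d = ∅ := by
      ext f
      simp only [irrSet, Set.mem_ofPred_eq, Set.mem_empty_iff_false, iff_false]
      rintro ⟨a, b, rfl, c, -⟩; exact hp c
    rw [this, if_neg hp]; simp

lemma sum_traceSet (n : ℕ) (hn : n ≠ 0) :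
    ∑ a ∈ Finset.univ.filter (fun a : ZMod p => a ≠ 0), (traceSet F p a n).ncard =
      (irrSet F (fun f => polyTrace F p f ≠ 0) n).ncard := by
  classical
  have hf := irrSet_finite F (fun f => polyTrace F p f ≠ 0) n hn
  rw [Set.ncard_eq_toFinset_card _ hf, Finset.card_eq_sum_card_fiberwise (f := polyTrace F p)
    (t := Finset.univ.filter (fun a : ZMod p => a ≠ 0))
    (by intro f hf'; simp [irrSet] at hf' ⊢; exact hf'.2.2.2)]
  refine Finset.sum_congr rfl fun a ha => ?_
  rw [← Set.ncard_coe_finset]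
  congr 1
  ext f
  simp only [traceSet, irrSet, Finset.coe_filter, Set.Finite.mem_toFinset, Set.mem_ofPred_eq]
  have := (Finset.mem_filter.1 ha).2
  constructor
  · rintro ⟨a, b, c, rfl⟩; exact ⟨⟨a, b, c, this⟩, rfl⟩
  · rintro ⟨⟨a, b, c, -⟩, d⟩; exact ⟨a, b, c, d⟩

lemma add_zero_set (n : ℕ) (hn : n ≠ 0) :
    (irrSet F (fun f => polyTrace F p f ≠ 0) n).ncard + (traceSet F p 0 n).ncard =
      (irrSet F (fun _ => True) n).ncard := by
  have hT : traceSet F p 0 n = irrSet F (fun f => polyTrace F p f = 0) n := rfl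
  rw [hT, ← Set.ncard_union_eq _ (irrSet_finite F _ n hn) (irrSet_finite F _ n hn)]
  · congr 1
    ext f
    simp only [irrSet, Set.mem_union, Set.mem_ofPred_eq]
    tauto
  · rw [Set.disjoint_left]
    rintro f ⟨_, _, _, h⟩ ⟨_, _, _, h'⟩
    exact h h'

end helpers

/-- Pure arithmetic part. -/
lemma arith_core (p : ℕ) (hp : p.Prime) (Q : ℕ → ℤ) (N M : ℕ → ℤ)
    (h1 : ∀ n : ℕ, n ≠ 0 → ∑ d ∈ n.divisors, (d : ℤ) * M d = Q n)
    (h2 : ∀ n : ℕ, n ≠ 0 → p * (∑ d ∈ n.divisors with ¬ p ∣ n / d, (d : ℤ) * N d) = (p - 1) * Q n)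
    (n : ℕ) (hn : n ≠ 0) :
    p * N n - (p - 1) * M n = if p ∣ n then N (n / p) else 0 := by
  set E : ℕ → ℤ := fun n => if p ∣ n then N (n / p) else 0 with hE
  have hpp := hp.pos
  have hdiv : ∀ m : ℕ, m ≠ 0 → (p * m).divisors.filter (fun d => p ∣ p * m / d) = m.divisors := by
    intro m hm
    ext d
    simp only [Finset.mem_filter, Nat.mem_divisors]
    constructor
    · rintro ⟨⟨⟨k, hk⟩, -⟩, h⟩
      have hd : 0 < d := Nat.pos_of_ne_zero (by rintro rfl; simp at hk; omega)
      rw [hk, Nat.mul_div_cancel_left _ hd] at h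
      obtain ⟨l, rfl⟩ := h
      refine ⟨⟨l, ?_⟩, hm⟩
      exact Nat.eq_of_mul_eq_mul_left hpp (by rw [hk]; ring)
    · rintro ⟨⟨k, rfl⟩, -⟩
      have hd : 0 < d := Nat.pos_of_ne_zero (by rintro rfl; simp at hm)
      refine ⟨⟨⟨p * k, by ring⟩, by positivity⟩, ⟨k, ?_⟩⟩
      rw [show p * (d * k) = d * (p * k) by ring, Nat.mul_div_cancel_left _ hd]
  have hdiv2 : ∀ m : ℕ, m ≠ 0 → (p * m).divisors.filter (fun d => ¬ p ∣ p * m / d) =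
      (m.divisors.filter (fun d => ¬ p ∣ m / d)).image (fun e => p * e) := by
    intro m hm
    ext d
    simp only [Finset.mem_filter, Nat.mem_divisors, Finset.mem_image]
    constructor
    · rintro ⟨⟨⟨k, hk⟩, h0⟩, h⟩
      have hd : 0 < d := Nat.pos_of_ne_zero (by rintro rfl; simp at hk; omega)
      rw [hk, Nat.mul_div_cancel_left _ hd] at h
      have : p ∣ d * k := ⟨m, hk.symm⟩
      obtain ⟨e, rfl⟩ := (hp.dvd_mul.1 this).resolve_right h
      have hm' : m = e * k := Nat.eq_of_mul_eq_mul_left hpp (by rw [hk]; ring)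
      have he : 0 < e := Nat.pos_of_mul_pos_left hd
      refine ⟨e, ⟨⟨⟨k, hm'⟩, hm⟩, ?_⟩, rfl⟩
      rwa [hm', Nat.mul_div_cancel_left _ he]
    · rintro ⟨e, ⟨⟨he, -⟩, h⟩, rfl⟩
      refine ⟨⟨Nat.mul_dvd_mul_left p he, by positivity⟩, ?_⟩
      rwa [Nat.mul_div_mul_left _ _ hpp]
  have key : ∀ n : ℕ, n ≠ 0 → ∑ d ∈ n.divisors with ¬ p ∣ n / d, (d : ℤ) * (p * N d - (p - 1) * M d)
      = ∑ d ∈ n.divisors with ¬ p ∣ n / d, (d : ℤ) * E d := by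
    intro n hn
    have e1 : ∑ d ∈ n.divisors with ¬ p ∣ n / d, (d : ℤ) * (p * N d - (p - 1) * M d)
        = (p - 1) * ∑ d ∈ n.divisors with p ∣ n / d, (d : ℤ) * M d := by
      have := Finset.sum_filter_add_sum_filter_not n.divisors (fun d => p ∣ n / d)
        (fun d => (d : ℤ) * M d)
      rw [h1 n hn] at this
      have e2 : ∑ d ∈ n.divisors with ¬ p ∣ n / d, (d : ℤ) * (p * N d - (p - 1) * M d) =
        p * (∑ d ∈ n.divisors with ¬ p ∣ n / d, (d : ℤ) * N d) -
          (p - 1) * ∑ d ∈ n.divisors with ¬ p ∣ n / d, (d : ℤ) * M d := by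
        rw [Finset.mul_sum, Finset.mul_sum, ← Finset.sum_sub_distrib]
        exact Finset.sum_congr rfl fun d _ => by ring
      rw [e2, h2 n hn, ← this]; ring
    rw [e1]
    by_cases hpn : p ∣ n
    · obtain ⟨m, rfl⟩ := hpn
      have hm : m ≠ 0 := by rintro rfl; simp at hn
      rw [hdiv m hm, hdiv2 m hm, h1 m hm, ← h2 m hm, Finset.sum_image
        (fun a _ b _ h => Nat.eq_of_mul_eq_mul_left hpp h), Finset.mul_sum]
      refine Finset.sum_congr rfl fun e _ => ?_
      simp only [hE, dvd_mul_right, if_true, Nat.mul_div_cancel_left _ hpp]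
      push_cast; ring
    · rw [Finset.sum_eq_zero, Finset.sum_eq_zero, mul_zero]
      · intro d hd
        have hd' := Nat.dvd_of_mem_divisors (Finset.mem_filter.1 hd).1
        have : ¬ p ∣ d := fun h => hpn (h.trans hd')
        simp [hE, this]
      · intro d hd
        obtain ⟨ha, hb⟩ := Finset.mem_filter.1 hd
        exact absurd (hb.trans (Nat.div_dvd_of_dvd (Nat.dvd_of_mem_divisors ha))) hpn
  change p * N n - (p - 1) * M n = E n
  induction n using Nat.strong_induction_on with
  | _ n ih =>
    have hk := key n hn
    have hmem : n ∈ n.divisors.filter (fun d => ¬ p ∣ n / d) := by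
      rw [Finset.mem_filter, Nat.div_self (Nat.pos_of_ne_zero hn)]
      exact ⟨Nat.mem_divisors_self n hn, hp.not_dvd_one⟩
    rw [← Finset.add_sum_erase _ _ hmem, ← Finset.add_sum_erase _ _ hmem,
      Finset.sum_congr rfl (fun d hd => ?_)] at hk
    · have := add_right_cancel hk
      exact mul_left_cancel₀ (by exact_mod_cast hn) this
    · obtain ⟨hne, hd⟩ := Finset.mem_erase.1 hd
      have hd' := (Finset.mem_filter.1 hd).1
      rw [ih d (lt_of_le_of_ne (Nat.divisor_le hd') hne) (Nat.pos_of_mem_divisors hd').ne']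

theorem trace_count_recursion (F : Type*) [Field F] [Fintype F]
    (p : ℕ) [Fact p.Prime] [CharP F p] (n : ℕ) (hn : 1 ≤ n) :
    (∑ a ∈ Finset.univ.filter (fun a : ZMod p => a ≠ 0),
        ((traceSet F p a n).ncard : ℤ))
      - (p - 1) * ((traceSet F p 0 n).ncard : ℤ)
      = if p ∣ n then
          ∑ a ∈ Finset.univ.filter (fun a : ZMod p => a ≠ 0),
            ((traceSet F p a (n / p)).ncard : ℤ)
        else 0 := by
  have hp : p.Prime := Fact.out
  have hn0 : n ≠ 0 := by omega
  have core := arith_core p hp (fun n => (Nat.card F : ℤ) ^ n)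
    (fun d => ((irrSet F (fun f => polyTrace F p f ≠ 0) d).ncard : ℤ))
    (fun d => ((irrSet F (fun _ => True) d).ncard : ℤ))
    (fun m hm => by exact_mod_cast sum_all F m hm)
    (fun m hm => by
      have := congrArg (Nat.cast : ℕ → ℤ) (sum_nonzero F p m hm)
      push_cast at this
      linarith) n hn0
  have hs : ∀ m : ℕ, m ≠ 0 → (∑ a ∈ Finset.univ.filter (fun a : ZMod p => a ≠ 0),
        ((traceSet F p a m).ncard : ℤ)) =
        ((irrSet F (fun f => polyTrace F p f ≠ 0) m).ncard : ℤ) := fun m hm => by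
    exact_mod_cast sum_traceSet F p m hm
  have hz : ((irrSet F (fun f => polyTrace F p f ≠ 0) n).ncard : ℤ) + (traceSet F p 0 n).ncard =
      (irrSet F (fun _ => True) n).ncard := by exact_mod_cast add_zero_set F p n hn0
  have hif : (if p ∣ n then ∑ a ∈ Finset.univ.filter (fun a : ZMod p => a ≠ 0),
            ((traceSet F p a (n / p)).ncard : ℤ) else 0) =
      if p ∣ n then ((irrSet F (fun f => polyTrace F p f ≠ 0) (n / p)).ncard : ℤ) else 0 := by
    split_ifs with h
    · exact hs _ (Nat.div_pos (Nat.le_of_dvd hn h) hp.pos).ne'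
    · rfl
  rw [hif, ← core, hs n hn0, ← hz]
  ring
end

section
/- Let q be an odd prime power and let u, v ∈ F_q with u ≠ v. For every integer n ≥ 2, the quantity |C_{u,v}(n)| − |D_{u,v}(n)| equals 0 if n is odd, and equals |C_{u,v}(n/2)| if n is even. -/
open Polynomial

/-- `C_{u,v}(n)`: monic irreducible polynomials `f` of degree `n` over `F_q` such
that `f(u)·f(v)` is a non-square in `F_q`. -/
def legendreNonsquareSet {F : Type*} [Field F] (u v : F) (n : ℕ) : Set F[X] :=
  {f : F[X] | f.Monic ∧ Irreducible f ∧ f.natDegree = n ∧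
    ¬ IsSquare (f.eval u * f.eval v)}

/-- `D_{u,v}(n)`: monic irreducible polynomials `f` of degree `n` over `F_q` such
that `f(u)·f(v)` is a square in `F_q`. -/
def legendreSquareSet {F : Type*} [Field F] (u v : F) (n : ℕ) : Set F[X] :=
  {f : F[X] | f.Monic ∧ Irreducible f ∧ f.natDegree = n ∧
    IsSquare (f.eval u * f.eval v)}

section aux
open IntermediateField

lemma lcr_isSquare_norm {E K : Type*} [Field E] [Field K] [Algebra E K] [Finite K]
    (h2 : ringChar E ≠ 2) (x : K) : IsSquare x ↔ IsSquare (Algebra.norm E x) := by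
  have := Finite.of_injective _ (algebraMap E K).injective
  have := Fintype.ofFinite E
  have := Fintype.ofFinite K
  have : FiniteDimensional E K := Module.Finite.of_finite
  by_cases hx : x = 0
  · simp [hx]
  have h2' : ringChar K ≠ 2 := by
    rwa [← Algebra.ringChar_eq E K]
  have hn : Algebra.norm E x ≠ 0 := by simpa [Algebra.norm_eq_zero_iff] using hx
  rw [FiniteField.isSquare_iff h2' hx, FiniteField.isSquare_iff h2 hn,
    ← (algebraMap E K).injective.eq_iff, map_pow, FiniteField.algebraMap_norm_eq_pow, map_one,
    ← pow_mul]
  have e : Fintype.card K / 2 =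
      (Nat.card K - 1) / (Nat.card E - 1) * (Fintype.card E / 2) := by
    rw [Nat.card_eq_fintype_card, Nat.card_eq_fintype_card]
    have hd : (Fintype.card E - 1) ∣ (Fintype.card K - 1) := by
      rw [Module.card_eq_pow_finrank (K := E) (V := K)]
      simpa using Nat.sub_dvd_pow_sub_pow (Fintype.card E) 1 (Module.finrank E K)
    obtain ⟨c, hc⟩ := hd
    have o1 := FiniteField.odd_card_of_char_ne_two h2
    have o2 := FiniteField.odd_card_of_char_ne_two h2'
    have g1 : 1 < Fintype.card E := Fintype.one_lt_card
    rw [hc, Nat.mul_div_cancel_left _ (by omega)]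
    have : Fintype.card E - 1 = 2 * (Fintype.card E / 2) := by omega
    rw [this] at hc
    have : Fintype.card K = 2 * (Fintype.card E / 2 * c) + 1 := by
      rw [← mul_assoc, ← hc]; omega
    rw [mul_comm c]
    omega
  rw [e]

lemma lcr_isSquare_of_finrank_two {E K : Type*} [Field E] [Field K] [Algebra E K] [Finite K]
    (h2 : ringChar E ≠ 2) (h : Module.finrank E K = 2) (x : E) :
    IsSquare (algebraMap E K x) := by
  rw [lcr_isSquare_norm h2, Algebra.norm_algebraMap, h]
  exact ⟨x, sq x⟩

variable {F K : Type*} [Field F] [Field K] [Algebra F K] [Finite K]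

lemma lcr_norm_sub (α : K) (u : F) :
    Algebra.norm F (algebraMap F F⟮α⟯ u - AdjoinSimple.gen F α) = (minpoly F α).eval u := by
  have := Finite.of_injective _ (algebraMap F K).injective
  have : FiniteDimensional F K := Module.Finite.of_finite
  have hi : IsIntegral F α := Algebra.IsIntegral.isIntegral α
  let pb := adjoin.powerBasis hi
  have h1 := charpoly_leftMulMatrix pb
  have hg : pb.gen = AdjoinSimple.gen F α := adjoin.powerBasis_gen hi
  rw [hg] at h1
  have h3 : minpoly F (AdjoinSimple.gen F α) = minpoly F α := minpoly_gen F α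
  rw [h3] at h1
  rw [← h1, Matrix.eval_charpoly, Algebra.norm_eq_matrix_det pb.basis, map_sub]
  congr 2
  rw [AlgHom.commutes]; rfl

lemma lcr_sq_iff (h2 : ringChar F ≠ 2) (α : K) (u v : F) :
    IsSquare ((minpoly F α).eval u * (minpoly F α).eval v) ↔
      ∃ y ∈ F⟮α⟯, y * y = (α - algebraMap F K u) * (α - algebraMap F K v) := by
  rw [← lcr_norm_sub, ← lcr_norm_sub, ← map_mul, ← lcr_isSquare_norm h2]
  constructor
  · rintro ⟨y, hy⟩
    refine ⟨y, y.2, ?_⟩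
    have := congrArg (algebraMap F⟮α⟯ K) hy
    simp only [map_mul, map_sub, AdjoinSimple.algebraMap_gen] at this
    rw [← IsScalarTower.algebraMap_apply, ← IsScalarTower.algebraMap_apply] at this
    change _ = (y : K) * (y : K) at this
    rw [← this]; ring
  · rintro ⟨y, hy, h⟩
    refine ⟨⟨y, hy⟩, ?_⟩
    apply (algebraMap F⟮α⟯ K).injective
    simp only [map_mul, map_sub, AdjoinSimple.algebraMap_gen]
    rw [← IsScalarTower.algebraMap_apply, ← IsScalarTower.algebraMap_apply]
    change _ = y * y
    rw [h]; ring

lemma lcr_fiber (f : F[X]) (hm : f.Monic) (hi : Irreducible f)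
    (hd : f.natDegree ∣ Module.finrank F K) :
    {x : K | minpoly F x = f}.ncard = f.natDegree := by
  have := Finite.of_injective _ (algebraMap F K).injective
  have : FiniteDimensional F K := Module.Finite.of_finite
  have := Fintype.ofFinite F
  have := Fintype.ofFinite K
  have : Fact (Irreducible f) := ⟨hi⟩
  have hr : Module.finrank F (AdjoinRoot f) = f.natDegree := by
    rw [(AdjoinRoot.powerBasis hi.ne_zero).finrank, AdjoinRoot.powerBasis_dim]
  obtain ⟨g⟩ := FiniteField.nonempty_algHom_of_finrank_dvd (F := F) (K := AdjoinRoot f) (L := K)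
    (by rwa [hr])
  have hroot : aeval (g (AdjoinRoot.root f)) f = 0 := by
    rw [aeval_algHom_apply, AdjoinRoot.aeval_eq, AdjoinRoot.mk_self, map_zero]
  have hmin := minpoly.eq_of_irreducible_of_monic hi hroot hm
  have hsplit : Splits (f.map (algebraMap F K)) := by
    rw [hmin]; exact Normal.splits inferInstance _
  have hsep : f.Separable := by
    rw [hmin]; exact Algebra.IsSeparable.isSeparable F _
  rw [← card_rootSet_eq_natDegree hsep hsplit, ← Nat.card_eq_fintype_card, Nat.card_coe_set_eq]
  congr 1
  ext x
  rw [mem_rootSet_of_ne hi.ne_zero]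
  constructor
  · rintro rfl; exact minpoly.aeval F x
  · intro h; exact (minpoly.eq_of_irreducible_of_monic hi h hm).symm

lemma lcr_count (P : Set F[X]) (d : ℕ) (hd : d ∣ Module.finrank F K) (hd0 : d ≠ 0)
    (hP : ∀ f ∈ P, f.Monic ∧ Irreducible f ∧ f.natDegree = d) :
    {x : K | minpoly F x ∈ P}.ncard = d * P.ncard := by
  classical
  have := Fintype.ofFinite K
  have himg : P = ((Finset.univ.filter (fun x : K => minpoly F x ∈ P)).image (minpoly F) :
      Finset F[X]) := by
    ext f
    simp only [Finset.coe_image, Finset.coe_filter, Finset.mem_univ, true_and, Set.mem_image,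
      Set.mem_ofPred_eq]
    constructor
    · intro hf
      obtain ⟨h1, h2, h3⟩ := hP f hf
      have := lcr_fiber (K := K) f h1 h2 (h3 ▸ hd)
      have hne : {x : K | minpoly F x = f}.Nonempty := by
        apply Set.nonempty_of_ncard_ne_zero; rw [this, h3]; exact hd0
      obtain ⟨x, hx⟩ := hne
      exact ⟨x, by rw [hx]; exact hf, hx⟩
    · rintro ⟨x, hx, rfl⟩; exact hx
  have hS : {x : K | minpoly F x ∈ P} = (Finset.univ.filter (fun x : K => minpoly F x ∈ P)) := by
    ext; simp
  rw [hS, Set.ncard_coe_finset]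
  conv_rhs => rw [himg]
  rw [Set.ncard_coe_finset, mul_comm, ← smul_eq_mul]
  rw [Finset.card_eq_sum_card_image (minpoly F)]
  apply Finset.sum_const_nat
  intro f hf
  have hfP : f ∈ P := by rw [himg]; exact hf
  obtain ⟨h1, h2, h3⟩ := hP f hfP
  rw [← h3, ← lcr_fiber (K := K) f h1 h2 (h3 ▸ hd), ← Set.ncard_coe_finset]
  congr 1
  ext x
  simp only [Finset.coe_filter, Finset.mem_filter, Finset.mem_univ, true_and, Set.mem_ofPred_eq]
  constructor
  · exact fun h => h.2
  · exact fun h => ⟨h ▸ hfP, h⟩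

/-- the target set -/
def LcrR (F : Type*) {K : Type*} [Field F] [Field K] [Algebra F K] (u v : F) (n : ℕ) (α : K) :
    Prop :=
  ((minpoly F α).natDegree = n ∧
    ∃ y ∈ F⟮α⟯, y * y = (α - algebraMap F K u) * (α - algebraMap F K v)) ∨
  (2 * (minpoly F α).natDegree = n ∧
    ¬ ∃ y ∈ F⟮α⟯, y * y = (α - algebraMap F K u) * (α - algebraMap F K v))

lemma lcr_deg (γ : K) : Module.finrank F F⟮γ⟯ = (minpoly F γ).natDegree := by
  have := Finite.of_injective _ (algebraMap F K).injective
  have : FiniteDimensional F K := Module.Finite.of_finite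
  exact adjoin.finrank (Algebra.IsIntegral.isIntegral γ)

lemma lcr_deg_top (γ : K) :
    (minpoly F γ).natDegree = Module.finrank F K ↔ F⟮γ⟯ = ⊤ := by
  have := Finite.of_injective _ (algebraMap F K).injective
  have : FiniteDimensional F K := Module.Finite.of_finite
  exact (Field.primitive_element_iff_minpoly_natDegree_eq F γ).symm

lemma lcr_rel {u v : F} (huv : u ≠ v) {γ α : K}
    (h : γ ^ 2 * (α - algebraMap F K v) = α - algebraMap F K u) :
    γ ^ 2 ≠ 1 ∧ α ≠ algebraMap F K v := by
  have huv' : algebraMap F K u ≠ algebraMap F K v := (algebraMap F K).injective.ne huv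
  constructor
  · intro h1; rw [h1, one_mul] at h; exact huv' (sub_right_injective h).symm
  · rintro rfl; rw [sub_self, mul_zero] at h; exact huv' (sub_eq_zero.mp h.symm).symm

lemma lcr_mem_iff {u v : F} (huv : u ≠ v) {γ α : K}
    (h : γ ^ 2 * (α - algebraMap F K v) = α - algebraMap F K u) :
    γ ∈ F⟮α⟯ ↔ ∃ y ∈ F⟮α⟯, y * y = (α - algebraMap F K u) * (α - algebraMap F K v) := by
  have hα : α ∈ F⟮α⟯ := mem_adjoin_simple_self F α
  have hv : α - algebraMap F K v ∈ F⟮α⟯ := sub_mem hα (F⟮α⟯.algebraMap_mem v)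
  have h0 : α - algebraMap F K v ≠ 0 := sub_ne_zero.mpr (lcr_rel huv h).2
  constructor
  · intro hg
    refine ⟨γ * (α - algebraMap F K v), mul_mem hg hv, ?_⟩
    rw [← h]; ring
  · rintro ⟨y, hy, hyy⟩
    have : (y - γ * (α - algebraMap F K v)) * (y + γ * (α - algebraMap F K v)) = 0 := by
      rw [← h] at hyy
      linear_combination hyy
    rcases mul_eq_zero.mp this with h' | h'
    · have : γ = y / (α - algebraMap F K v) := by
        rw [eq_div_iff h0]; linear_combination -h'
      rw [this]; exact div_mem hy hv
    · have : γ = -y / (α - algebraMap F K v) := by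
        rw [eq_div_iff h0]; linear_combination h'
      rw [this]; exact div_mem (neg_mem hy) hv

lemma lcr_iff {u v : F} (huv : u ≠ v) {γ α : K}
    (h : γ ^ 2 * (α - algebraMap F K v) = α - algebraMap F K u) :
    (minpoly F γ).natDegree = Module.finrank F K ↔ LcrR F u v (Module.finrank F K) α := by
  have := Finite.of_injective _ (algebraMap F K).injective
  have : FiniteDimensional F K := Module.Finite.of_finite
  have hα : α ∈ F⟮α⟯ := mem_adjoin_simple_self F α
  have hγ : γ ∈ F⟮γ⟯ := mem_adjoin_simple_self F γ
  obtain ⟨hg1, hav⟩ := lcr_rel huv h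
  unfold LcrR
  rw [← lcr_mem_iff huv h, lcr_deg_top, lcr_deg_top]
  have hle : F⟮α⟯ ≤ F⟮γ⟯ := by
    rw [adjoin_simple_le_iff]
    have : α = (algebraMap F K u - algebraMap F K v * γ ^ 2) / (1 - γ ^ 2) := by
      rw [eq_div_iff (sub_ne_zero.mpr hg1.symm)]; linear_combination -h
    rw [this]
    exact div_mem (sub_mem (F⟮γ⟯.algebraMap_mem u)
      (mul_mem (F⟮γ⟯.algebraMap_mem v) (pow_mem hγ 2))) (sub_mem (one_mem _) (pow_mem hγ 2))
  have hsq : γ ^ 2 ∈ F⟮α⟯ := by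
    have : γ ^ 2 = (α - algebraMap F K u) / (α - algebraMap F K v) := by
      rw [eq_div_iff (sub_ne_zero.mpr hav)]; exact h
    rw [this]
    exact div_mem (sub_mem hα (F⟮α⟯.algebraMap_mem u)) (sub_mem hα (F⟮α⟯.algebraMap_mem v))
  have hmul := Module.finrank_mul_finrank F F⟮α⟯ K
  have hpos : 0 < Module.finrank F K := Module.finrank_pos
  constructor
  · intro ht
    by_cases hg : γ ∈ F⟮α⟯
    · left
      refine ⟨?_, hg⟩
      rw [eq_top_iff, ← ht, adjoin_simple_le_iff]; exact hg
    · right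
      refine ⟨?_, hg⟩
      rw [← lcr_deg]
      have htop : F⟮α⟯⟮γ⟯ = ⊤ := by
        rw [← restrictScalars_eq_top_iff (K := F), eq_top_iff, ← ht, adjoin_simple_le_iff]
        exact mem_adjoin_simple_self _ γ
      have hint : IsIntegral F⟮α⟯ γ := Algebra.IsIntegral.isIntegral γ
      have hfr : Module.finrank F⟮α⟯ K = (minpoly F⟮α⟯ γ).natDegree :=
        ((Field.primitive_element_iff_minpoly_natDegree_eq F⟮α⟯ γ).mp htop).symm
      have hle2 : (minpoly F⟮α⟯ γ).natDegree ≤ 2 := by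
        have hmon : (X ^ 2 - C (⟨γ ^ 2, hsq⟩ : F⟮α⟯)).Monic := monic_X_pow_sub_C _ two_ne_zero
        have h0 : aeval γ (X ^ 2 - C (⟨γ ^ 2, hsq⟩ : F⟮α⟯)) = 0 := by
          simp only [map_sub, map_pow, aeval_X, aeval_C]
          exact sub_self _
        have := natDegree_le_of_dvd (minpoly.dvd _ _ h0) hmon.ne_zero
        simpa using this
      have hne1 : (minpoly F⟮α⟯ γ).natDegree ≠ 1 := by
        intro h1
        rw [minpoly.natDegree_eq_one_iff] at h1
        obtain ⟨z, hz⟩ := h1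
        exact hg (hz ▸ z.2)
      have : 0 < (minpoly F⟮α⟯ γ).natDegree := minpoly.natDegree_pos hint
      have h2 : Module.finrank F⟮α⟯ K = 2 := by omega
      rw [h2] at hmul; omega
  · rintro (⟨h1, -⟩ | ⟨h1, hg⟩)
    · rw [eq_top_iff, ← h1]; exact hle
    · rw [← lcr_deg] at h1
      have hd1 : Module.finrank F F⟮α⟯ ∣ Module.finrank F F⟮γ⟯ := by
        exact finrank_dvd_of_le_right hle
      have hmul2 := Module.finrank_mul_finrank F F⟮γ⟯ K
      obtain ⟨k, hk⟩ := hd1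
      have hp : 0 < Module.finrank F F⟮α⟯ := Module.finrank_pos
      have hk2 : k * Module.finrank F⟮γ⟯ K = 2 := by
        apply Nat.eq_of_mul_eq_mul_left hp
        rw [← mul_assoc, ← hk, hmul2, ← h1, mul_comm]
      rcases (Nat.dvd_prime Nat.prime_two).mp ⟨_, hk2.symm⟩ with rfl | rfl
      · exfalso
        apply hg
        rw [eq_of_le_of_finrank_eq hle (by omega)]
        exact hγ
      · apply eq_of_le_of_finrank_eq le_top
        rw [finrank_top']; omega

lemma lcr_exists (h2 : ringChar F ≠ 2) {u v : F} (hn : 2 ≤ Module.finrank F K) {α : K}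
    (h : LcrR F u v (Module.finrank F K) α) :
    ∃ γ : K, γ ≠ 0 ∧ γ ^ 2 * (α - algebraMap F K v) = α - algebraMap F K u := by
  have := Finite.of_injective _ (algebraMap F K).injective
  have : FiniteDimensional F K := Module.Finite.of_finite
  have hα : α ∈ F⟮α⟯ := mem_adjoin_simple_self F α
  have key : ∀ y : K, y * y = (α - algebraMap F K u) * (α - algebraMap F K v) →
      α - algebraMap F K u ≠ 0 → α - algebraMap F K v ≠ 0 →
      ∃ γ : K, γ ≠ 0 ∧ γ ^ 2 * (α - algebraMap F K v) = α - algebraMap F K u := by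
    intro y hy h0 h1
    refine ⟨y / (α - algebraMap F K v), div_ne_zero ?_ h1, ?_⟩
    · rintro rfl
      rw [zero_mul] at hy
      exact mul_ne_zero h0 h1 hy.symm
    · field_simp
      rw [sq, hy, mul_comm]
  rcases h with ⟨hd, y, -, hy⟩ | ⟨hd, hns⟩
  · have hne : ∀ w : F, α - algebraMap F K w ≠ 0 := by
      intro w hw
      rw [sub_eq_zero] at hw
      rw [hw, minpoly.eq_X_sub_C, natDegree_X_sub_C] at hd
      omega
    exact key y hy (hne _) (hne _)
  · have h0 : (α - algebraMap F K u) * (α - algebraMap F K v) ≠ 0 := by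
      intro h0
      exact hns ⟨0, zero_mem _, by rw [h0, mul_zero]⟩
    have hmul := Module.finrank_mul_finrank F F⟮α⟯ K
    rw [← lcr_deg] at hd
    have hp : 0 < Module.finrank F F⟮α⟯ := Module.finrank_pos
    have hf : Module.finrank F⟮α⟯ K = 2 := by
      apply Nat.eq_of_mul_eq_mul_left hp
      rw [hmul, ← hd, mul_comm]
    have h2' : ringChar F⟮α⟯ ≠ 2 := by
      rwa [← Algebra.ringChar_eq F F⟮α⟯]
    obtain ⟨y, hy⟩ := lcr_isSquare_of_finrank_two h2' hf
      ⟨(α - algebraMap F K u) * (α - algebraMap F K v),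
        mul_mem (sub_mem hα (F⟮α⟯.algebraMap_mem u)) (sub_mem hα (F⟮α⟯.algebraMap_mem v))⟩
    exact key y hy.symm (left_ne_zero_of_mul h0) (right_ne_zero_of_mul h0)

lemma lcr_card (h2 : ringChar F ≠ 2) {u v : F} (huv : u ≠ v) (hn : 2 ≤ Module.finrank F K) :
    {γ : K | (minpoly F γ).natDegree = Module.finrank F K}.ncard =
      2 * {α : K | LcrR F u v (Module.finrank F K) α}.ncard := by
  classical
  have := Finite.of_injective _ (algebraMap F K).injective
  have : FiniteDimensional F K := Module.Finite.of_finite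
  have := Fintype.ofFinite K
  have h2K : ringChar K ≠ 2 := by rwa [← Algebra.ringChar_eq F K]
  have e1 : {γ : K | (minpoly F γ).natDegree = Module.finrank F K} =
    (Finset.univ.filter (fun γ : K => (minpoly F γ).natDegree = Module.finrank F K)) := by
    ext; simp
  have e2 : {α : K | LcrR F u v (Module.finrank F K) α} =
    (Finset.univ.filter (fun α : K => LcrR F u v (Module.finrank F K) α)) := by
    ext; simp
  rw [e1, e2, Set.ncard_coe_finset, Set.ncard_coe_finset]
  let φ : K → K := fun γ => (algebraMap F K u - algebraMap F K v * γ ^ 2) / (1 - γ ^ 2)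
  have hφ : ∀ γ : K, γ ^ 2 ≠ 1 →
      γ ^ 2 * (φ γ - algebraMap F K v) = φ γ - algebraMap F K u := by
    intro γ hγ
    have : 1 - γ ^ 2 ≠ 0 := sub_ne_zero.mpr hγ.symm
    simp only [φ]
    field_simp
    ring
  have hT : ∀ γ : K, (minpoly F γ).natDegree = Module.finrank F K → γ ^ 2 ≠ 1 := by
    intro γ hγ h1
    have hc : ∃ w : F, γ = algebraMap F K w := by
      rcases (mul_self_eq_one_iff.mp (by rw [← sq]; exact h1) : γ = 1 ∨ γ = -1) with h | h
      · exact ⟨1, by simp [h]⟩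
      · exact ⟨-1, by simp [h]⟩
    obtain ⟨w, rfl⟩ := hc
    rw [minpoly.eq_X_sub_C, natDegree_X_sub_C] at hγ
    omega
  rw [Finset.card_eq_sum_card_fiberwise (f := φ)
    (t := Finset.univ.filter (fun α : K => LcrR F u v (Module.finrank F K) α))]
  · rw [mul_comm]
    apply Finset.sum_const_nat
    intro α hα
    rw [Finset.mem_filter] at hα
    obtain ⟨γ, hγ0, hγ⟩ := lcr_exists h2 hn hα.2
    have hαv := (lcr_rel huv hγ).2
    rw [← Finset.card_pair (a := γ) (b := -γ)]
    · congr 1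
      ext δ
      simp only [Finset.mem_filter, Finset.mem_univ, true_and, Finset.mem_insert,
        Finset.mem_singleton]
      rw [← sq_eq_sq_iff_eq_or_eq_neg]
      constructor
      · rintro ⟨h3, h4⟩
        have := hφ δ (hT δ h3)
        rw [h4, ← hγ] at this
        exact mul_right_cancel₀ (sub_ne_zero.mpr hαv) this
      · intro h3
        have h4 := hγ
        rw [← h3] at h4
        refine ⟨(lcr_iff huv h4).mpr hα.2, ?_⟩
        simp only [φ]
        rw [div_eq_iff (sub_ne_zero.mpr (lcr_rel huv h4).1.symm)]
        linear_combination h4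
    · intro h
      exact hγ0 (Ring.eq_self_iff_eq_zero_of_char_ne_two h2K |>.mp h.symm)
  · intro γ hγ
    simp only [Finset.coe_filter, Finset.mem_univ, true_and, Set.mem_ofPred_eq] at hγ ⊢
    exact (lcr_iff huv (hφ γ (hT γ hγ))).mp hγ

end aux

theorem legendre_count_recursion (F : Type*) [Field F] [Fintype F]
    (hq : Odd (Fintype.card F)) (u v : F) (huv : u ≠ v) (n : ℕ) (hn : 2 ≤ n) :
    ((legendreNonsquareSet u v n).ncard : ℤ) - ((legendreSquareSet u v n).ncard : ℤ)
      = if 2 ∣ n then ((legendreNonsquareSet u v (n / 2)).ncard : ℤ) else 0 := by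
  classical
  have hchar : ringChar F ≠ 2 := by
    intro h
    have := FiniteField.even_card_of_char_two h
    rcases hq with ⟨k, hk⟩
    omega
  obtain ⟨p, hp⟩ := CharP.exists F
  have hpp : Fact p.Prime := ⟨CharP.char_is_prime F p⟩
  have hn0 : NeZero n := ⟨by omega⟩
  let K := FiniteField.Extension F p n
  have hK : Module.finrank F K = n := FiniteField.finrank_extension F p n
  have : FiniteDimensional F K := Module.Finite.of_finite
  have hint : ∀ x : K, IsIntegral F x := fun x => Algebra.IsIntegral.isIntegral x
  have hmain := lcr_card (K := K) hchar huv (by omega)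
  rw [hK] at hmain
  have hC := lcr_count (K := K) (legendreNonsquareSet u v n) n (by rw [hK]) (by omega)
    (fun f hf => ⟨hf.1, hf.2.1, hf.2.2.1⟩)
  have hD := lcr_count (K := K) (legendreSquareSet u v n) n (by rw [hK]) (by omega)
    (fun f hf => ⟨hf.1, hf.2.1, hf.2.2.1⟩)
  have hT : {γ : K | (minpoly F γ).natDegree = n} =
      {x : K | minpoly F x ∈ legendreNonsquareSet u v n} ∪
      {x : K | minpoly F x ∈ legendreSquareSet u v n} := by
    ext x
    have h1 := minpoly.monic (hint x)
    have h2 := minpoly.irreducible (hint x)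
    simp only [legendreNonsquareSet, legendreSquareSet, Set.mem_union, Set.mem_ofPred_eq]
    tauto
  rw [hT, Set.ncard_union_eq (by
    rw [Set.disjoint_left]; intro x h1 h2; exact h1.2.2.2 h2.2.2.2) (Set.toFinite _)
    (Set.toFinite _), hC, hD] at hmain
  by_cases h2 : 2 ∣ n
  · obtain ⟨m, rfl⟩ := h2
    rw [if_pos (dvd_mul_right 2 m), Nat.mul_div_cancel_left m two_pos]
    have hC2 := lcr_count (K := K) (legendreNonsquareSet u v m) m
      (by rw [hK]; exact dvd_mul_left m 2) (by omega) (fun f hf => ⟨hf.1, hf.2.1, hf.2.2.1⟩)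
    have hR : {α : K | LcrR F u v (2 * m) α} =
        {x : K | minpoly F x ∈ legendreSquareSet u v (2 * m)} ∪
        {x : K | minpoly F x ∈ legendreNonsquareSet u v m} := by
      ext x
      have h1 := minpoly.monic (hint x)
      have h2 := minpoly.irreducible (hint x)
      have h3 : 2 * (minpoly F x).natDegree = 2 * m ↔ (minpoly F x).natDegree = m := by omega
      simp only [legendreNonsquareSet, legendreSquareSet, Set.mem_union, Set.mem_ofPred_eq,
        LcrR, ← lcr_sq_iff hchar, h3]
      tauto
    rw [hR, Set.ncard_union_eq (by
      rw [Set.disjoint_left]; intro x h1 h2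
      have h3 := h1.2.2.1
      have h4 := h2.2.2.1
      omega) (Set.toFinite _) (Set.toFinite _), hD, hC2] at hmain
    have hm : (2 * m : ℤ) ≠ 0 := by omega
    apply mul_left_cancel₀ hm
    zify at hmain
    linear_combination hmain
  · rw [if_neg h2]
    have hR : {α : K | LcrR F u v n α} =
        {x : K | minpoly F x ∈ legendreSquareSet u v n} := by
      ext x
      have h1 := minpoly.monic (hint x)
      have h2 := minpoly.irreducible (hint x)
      have h3 : ¬ 2 * (minpoly F x).natDegree = n := by omega
      simp only [legendreSquareSet, Set.mem_ofPred_eq, LcrR, ← lcr_sq_iff hchar]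
      tauto
    rw [hR, hD] at hmain
    have hm : (n : ℤ) ≠ 0 := by omega
    apply mul_left_cancel₀ hm
    zify at hmain
    linear_combination hmain
end

section
/- Let F_q be a finite field, let G ≤ PGL_2(F_q) be a cyclic subgroup of prime order s, and let Q_G = g/h be a quotient map for G. Then for all integers n > d(G), the quantity |C(Q_G, n)| − (s−1)·|D(Q_G, n)| equals 0 if s does not divide n, and equals |C(Q_G, n/s)| if s divides n. -/
open Polynomial

/-- `PGL₂(F)`: the quotient of `GL₂(F)` by its center. -/
abbrev PGL2 (F : Type*) [Field F] :=
  GL (Fin 2) F ⧸ Subgroup.center (GL (Fin 2) F)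

/-- The class of `A ∈ GL₂(F)` in `PGL₂(F)`. -/
abbrev PGL2.mk {F : Type*} [Field F] (A : GL (Fin 2) F) : PGL2 F :=
  QuotientGroup.mk A

/-- The Möbius function `(ax + b)/(cx + d)` associated to `A ∈ GL₂(F)`, as a
rational function over `F`. -/
noncomputable def mobiusRatFunc {F : Type*} [Field F] (A : GL (Fin 2) F) : RatFunc F :=
  (RatFunc.C (A.val 0 0) * RatFunc.X + RatFunc.C (A.val 0 1)) /
    (RatFunc.C (A.val 1 0) * RatFunc.X + RatFunc.C (A.val 1 1))

/-- The rational transform `f^Q = Σ_{i=0}^{deg f} f_i g^i h^{deg f - i}` of a monic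
polynomial `f` with the rational function `Q = g/h`. -/
noncomputable def ratTransform {F : Type*} [Field F] (g h f : F[X]) : F[X] :=
  ∑ i ∈ Finset.range (f.natDegree + 1), C (f.coeff i) * g ^ i * h ^ (f.natDegree - i)

/-- `Q = g/h` is a quotient map for the subgroup `G ≤ PGL₂(F)`: `g, h` are coprime,
`g` is monic of degree `|G|`, `0 ≤ deg h < deg g`, and `Q` is `G`-invariant, i.e.
`Q ∘ ([A] ∘ x) = Q` for all `[A] ∈ G` (equivalently, `F(Q) = F(x)^G`). -/
def IsQuotientMap {F : Type*} [Field F] (G : Subgroup (PGL2 F)) (g h : F[X]) : Prop :=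
  g.Monic ∧ IsCoprime g h ∧ h ≠ 0 ∧ h.natDegree < g.natDegree ∧
    g.natDegree = Nat.card G ∧
    ∀ A : GL (Fin 2) F, PGL2.mk A ∈ G →
      Polynomial.aeval (mobiusRatFunc A) g / Polynomial.aeval (mobiusRatFunc A) h
        = algebraMap F[X] (RatFunc F) g / algebraMap F[X] (RatFunc F) h

/-- `d(Q)` for `Q = g/h`: the largest degree of a monic irreducible polynomial `f`
such that `f^Q` is not squarefree (`0` if no such polynomial exists). -/
noncomputable def dval {F : Type*} [Field F] (g h : F[X]) : ℕ :=
  sSup {n : ℕ | ∃ f : F[X], f.Monic ∧ Irreducible f ∧ f.natDegree = n ∧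
    ¬ Squarefree (ratTransform g h f)}

/-- `C(Q, n)`: monic irreducible polynomials of degree `n` whose `Q`-transform is
irreducible. -/
def transformIrredSet {F : Type*} [Field F] (g h : F[X]) (n : ℕ) : Set F[X] :=
  {f : F[X] | f.Monic ∧ Irreducible f ∧ f.natDegree = n ∧
    Irreducible (ratTransform g h f)}

/-- `D(Q, n)`: monic irreducible polynomials of degree `n` whose `Q`-transform is
not irreducible. -/
def transformRedSet {F : Type*} [Field F] (g h : F[X]) (n : ℕ) : Set F[X] :=
  {f : F[X] | f.Monic ∧ Irreducible f ∧ f.natDegree = n ∧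
    ¬ Irreducible (ratTransform g h f)}


/-- Möbius relation `y = A x` with finite value. -/
def MR {F : Type*} [Field F] (K : Type*) [Field K] [Algebra F K] (A : GL (Fin 2) F) (x y : K) : Prop :=
  algebraMap F K (A.val 1 0) * x + algebraMap F K (A.val 1 1) ≠ 0 ∧
  algebraMap F K (A.val 0 0) * x + algebraMap F K (A.val 0 1) =
    (algebraMap F K (A.val 1 0) * x + algebraMap F K (A.val 1 1)) * y

section mob
variable {F : Type*} [Field F] {K : Type*} [Field K] [Algebra F K]

lemma MR.comp {A B : GL (Fin 2) F} {x y z : K} (h1 : MR K A x y) (h2 : MR K B y z) :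
    MR K (B * A) x z := by
  obtain ⟨h1, h1'⟩ := h1
  obtain ⟨h2, h2'⟩ := h2
  have e1 : algebraMap F K ((B * A).val 1 0) * x + algebraMap F K ((B * A).val 1 1) =
     (algebraMap F K (B.val 1 0) * y + algebraMap F K (B.val 1 1)) *
      (algebraMap F K (A.val 1 0) * x + algebraMap F K (A.val 1 1)) := by
    simp only [Units.val_mul, Matrix.mul_apply, Fin.sum_univ_two, map_add, map_mul]
    linear_combination (algebraMap F K (B.val 1 0)) * h1'
  refine ⟨?_, ?_⟩
  · rw [e1]; exact mul_ne_zero h2 h1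
  · rw [e1]
    simp only [Units.val_mul, Matrix.mul_apply, Fin.sum_univ_two, map_add, map_mul]
    linear_combination (algebraMap F K (B.val 0 0)) * h1' +
      (algebraMap F K (A.val 1 0) * x + algebraMap F K (A.val 1 1)) * h2'

lemma MR.unique {A : GL (Fin 2) F} {x y z : K} (h1 : MR K A x y) (h2 : MR K A x z) : y = z :=
  mul_left_cancel₀ h1.1 (h1.2.symm.trans h2.2)

lemma MR.one (x : K) : MR K (1 : GL (Fin 2) F) x x := by
  constructor <;> simp

lemma central_entries {Z : GL (Fin 2) F} (hZ : Z ∈ Subgroup.center (GL (Fin 2) F)) :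
    Z.val 0 1 = 0 ∧ Z.val 1 0 = 0 ∧ Z.val 0 0 = Z.val 1 1 := by
  rw [Subgroup.mem_center_iff] at hZ
  have h1 := hZ (Matrix.GeneralLinearGroup.mkOfDetNeZero !![1, 1; 0, 1] (by simp))
  have h2 := hZ (Matrix.GeneralLinearGroup.mkOfDetNeZero !![1, 0; 1, 1] (by simp))
  have h1 := congrArg Units.val h1
  have h2 := congrArg Units.val h2
  have a1 := congrFun (congrFun h1 0) 0
  have a2 := congrFun (congrFun h1 0) 1
  have a3 := congrFun (congrFun h2 0) 0
  simp [Matrix.mul_apply, Fin.sum_univ_two, Matrix.GeneralLinearGroup.mkOfDetNeZero] at a1 a2 a3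
  refine ⟨a3, a1, ?_⟩
  linear_combination -a2

lemma central_of_entries {Z : GL (Fin 2) F}
    (h : Z.val 0 1 = 0 ∧ Z.val 1 0 = 0 ∧ Z.val 0 0 = Z.val 1 1) :
    Z ∈ Subgroup.center (GL (Fin 2) F) := by
  obtain ⟨h1, h2, h3⟩ := h
  rw [Subgroup.mem_center_iff]
  intro B
  ext i j
  fin_cases i <;> fin_cases j <;>
   simp [Matrix.mul_apply, Fin.sum_univ_two, h1, h2, h3, mul_comm]

lemma MR.central {Z : GL (Fin 2) F} (hZ : Z ∈ Subgroup.center (GL (Fin 2) F)) (x : K) :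
    MR K Z x x := by
  obtain ⟨h1, h2, h3⟩ := central_entries hZ
  have hd : Z.val 1 1 ≠ 0 := by
    intro h0
    have := Z.isUnit.map Matrix.detMonoidHom
    simp [Matrix.det_fin_two, h1, h2, h0] at this
  constructor <;> simp [h1, h2, h3, hd]

lemma det_ne (A : GL (Fin 2) F) :
    A.val 0 0 * A.val 1 1 - A.val 0 1 * A.val 1 0 ≠ 0 := by
  have := A.isUnit.map Matrix.detMonoidHom
  simpa [Matrix.det_fin_two] using this

lemma mk_eq_of_entries {A B : GL (Fin 2) F}
    (h1 : A.val 0 0 * B.val 1 0 = B.val 0 0 * A.val 1 0)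
    (h2 : A.val 0 1 * B.val 1 1 = B.val 0 1 * A.val 1 1)
    (h3 : A.val 0 0 * B.val 1 1 + A.val 0 1 * B.val 1 0 =
      B.val 0 0 * A.val 1 1 + B.val 0 1 * A.val 1 0) : PGL2.mk A = PGL2.mk B := by
  apply QuotientGroup.eq.2
  apply central_of_entries
  have e : ∀ i j, (A⁻¹ * B).val i j = (A.val⁻¹ * B.val) i j := by simp
  simp only [e, Matrix.inv_def, Matrix.adjugate_fin_two, Matrix.smul_apply,
    Matrix.mul_apply, Fin.sum_univ_two, Matrix.of_apply, Matrix.cons_val_zero, Matrix.cons_val_one,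
    Matrix.cons_val', smul_eq_mul]
  refine ⟨?_, ?_, ?_⟩
  · simp only [Ring.inverse_eq_inv']; simp; linear_combination (-(A.val.det)⁻¹) * h2
  · simp only [Ring.inverse_eq_inv']; simp; linear_combination (A.val.det)⁻¹ * h1
  · simp only [Ring.inverse_eq_inv']; simp; linear_combination (-(A.val.det)⁻¹) * h3

/-- The quadratic polynomial detecting coincidences of two Möbius maps. -/
noncomputable def quadPoly (A B : GL (Fin 2) F) : F[X] :=
  (C (A.val 0 0) * X + C (A.val 0 1)) * (C (B.val 1 0) * X + C (B.val 1 1)) -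
  (C (B.val 0 0) * X + C (B.val 0 1)) * (C (A.val 1 0) * X + C (A.val 1 1))

lemma mk_eq_of_quadPoly {A B : GL (Fin 2) F} (h : quadPoly A B = 0) :
    PGL2.mk A = PGL2.mk B := by
  have e : quadPoly A B = C (A.val 0 0 * B.val 1 0 - B.val 0 0 * A.val 1 0) * X ^ 2 +
     C (A.val 0 0 * B.val 1 1 + A.val 0 1 * B.val 1 0 -
      (B.val 0 0 * A.val 1 1 + B.val 0 1 * A.val 1 0)) * X +
     C (A.val 0 1 * B.val 1 1 - B.val 0 1 * A.val 1 1) := by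
    simp only [quadPoly, map_sub, map_add, map_mul]
    ring
  rw [e] at h
  have c0 := congrArg (fun p => coeff p 0) h
  have c1 := congrArg (fun p => coeff p 1) h
  have c2 := congrArg (fun p => coeff p 2) h
  simp only [coeff_add, coeff_C_mul, coeff_X_pow, coeff_X, coeff_C, coeff_zero] at c0 c1 c2
  simp at c0 c1 c2
  exact mk_eq_of_entries (by linear_combination c2) (by linear_combination c0)
    (by linear_combination c1)

lemma MR.quad {A B : GL (Fin 2) F} {x y : K} (h1 : MR K A x y) (h2 : MR K B x y) :
    aeval x (quadPoly A B) = 0 := by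
  simp only [quadPoly, map_sub, map_add, map_mul, aeval_X, aeval_C]
  rw [h1.2, h2.2]; ring

lemma den_ratFunc_ne (A : GL (Fin 2) F) :
    (C (A.val 1 0) * X + C (A.val 1 1) : F[X]) ≠ 0 := by
  intro h
  have c0 := congrArg (fun p => coeff p 0) h
  have c1 := congrArg (fun p => coeff p 1) h
  simp at c0 c1
  exact det_ne A (by rw [c0, c1]; ring)

lemma mobiusRatFunc_inj {A B : GL (Fin 2) F} (h : mobiusRatFunc A = mobiusRatFunc B) :
    PGL2.mk A = PGL2.mk B := by
  apply mk_eq_of_quadPoly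
  have hA : (algebraMap F[X] (RatFunc F)) (C (A.val 1 0) * X + C (A.val 1 1)) ≠ 0 := by
    exact fun h0 => den_ratFunc_ne A (IsFractionRing.injective F[X] (RatFunc F) (by rw [h0, map_zero]))
  have hB : (algebraMap F[X] (RatFunc F)) (C (B.val 1 0) * X + C (B.val 1 1)) ≠ 0 := by
    exact fun h0 => den_ratFunc_ne B (IsFractionRing.injective F[X] (RatFunc F) (by rw [h0, map_zero]))
  apply IsFractionRing.injective F[X] (RatFunc F)
  simp only [map_add, map_mul, RatFunc.algebraMap_C, RatFunc.algebraMap_X] at hA hB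
  simp only [mobiusRatFunc] at h
  rw [div_eq_div_iff hA hB] at h
  simp only [quadPoly, map_sub, map_add, map_mul, RatFunc.algebraMap_C, RatFunc.algebraMap_X,
    map_zero]
  rw [h]; ring

/-- Möbius iterates. -/
lemma MR.iterate {B : GL (Fin 2) F} {x : K} (ψ : K →ₐ[F] K) (h : MR K B x (ψ x)) (k : ℕ) :
    MR K (B ^ k) x ((ψ ^ k) x) := by
  induction k with
  | zero => simpa using MR.one x
  | succ k ih =>
    rw [pow_succ, pow_succ']
    have h2 : MR K B x (ψ x) := h
    have h3 : MR K (B ^ k) (ψ x) (ψ ((ψ ^ k) x)) := by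
      obtain ⟨i1, i2⟩ := ih
      refine ⟨fun h0 => i1 ?_, ?_⟩
      · apply ψ.toRingHom.injective
        simpa using h0
      · have := congrArg ψ i2
        simpa using this
    exact h2.comp h3

end mob

section quot
variable {F : Type*} [Field F]

/-- numerator -/
noncomputable def numP (A : GL (Fin 2) F) : F[X] := C (A.val 0 0) * X + C (A.val 0 1)
/-- denominator -/
noncomputable def denP (A : GL (Fin 2) F) : F[X] := C (A.val 1 0) * X + C (A.val 1 1)

/-- representative -/
noncomputable def repG {G : Subgroup (PGL2 F)} (σ : G) : GL (Fin 2) F := Quotient.out σ.1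

lemma repG_mk {G : Subgroup (PGL2 F)} (σ : G) : PGL2.mk (repG σ) = σ.1 := Quotient.out_eq _

lemma mobius_eq_div (A : GL (Fin 2) F) : mobiusRatFunc A =
    algebraMap F[X] (RatFunc F) (numP A) / algebraMap F[X] (RatFunc F) (denP A) := by
  simp [mobiusRatFunc, numP, denP]

lemma key_ratFunc (G : Subgroup (PGL2 F)) [Fintype G] (g h : F[X]) (hQ : IsQuotientMap G g h) :
    g.map (algebraMap F (RatFunc F)) * C (algebraMap F[X] (RatFunc F) h) -
      h.map (algebraMap F (RatFunc F)) * C (algebraMap F[X] (RatFunc F) g) =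
    C (algebraMap F[X] (RatFunc F) h) * ∏ σ : G, (X - C (mobiusRatFunc (repG σ))) := by
  obtain ⟨hm, hcop, h0, hdeg, hcard, hinv⟩ := hQ
  have hh : algebraMap F[X] (RatFunc F) h ≠ 0 :=
    fun e => h0 (IsFractionRing.injective F[X] (RatFunc F) (by rw [e, map_zero]))
  have hg : algebraMap F[X] (RatFunc F) g ≠ 0 :=
    fun e => hm.ne_zero (IsFractionRing.injective F[X] (RatFunc F) (by rw [e, map_zero]))
  have hcard' : g.natDegree = Fintype.card G := by rw [hcard, Nat.card_eq_fintype_card]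
  have hprodm : (∏ σ : G, (X - C (mobiusRatFunc (repG σ)))).Monic :=
    monic_prod_of_monic _ _ fun _ _ => monic_X_sub_C _
  have hprodd : (∏ σ : G, (X - C (mobiusRatFunc (repG σ)))).degree = (Fintype.card G : WithBot ℕ) := by
    rw [degree_prod]; simp
  apply eq_of_degree_sub_lt_of_eval_index_eq (s := (Finset.univ : Finset G))
    (v := fun σ => mobiusRatFunc (repG σ))
  · intro σ _ τ _ hst
    have := mobiusRatFunc_inj hst
    rw [repG_mk, repG_mk] at this
    exact Subtype.ext this
  · have e : g.map (algebraMap F (RatFunc F)) * C (algebraMap F[X] (RatFunc F) h) -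
      h.map (algebraMap F (RatFunc F)) * C (algebraMap F[X] (RatFunc F) g) -
      C (algebraMap F[X] (RatFunc F) h) * ∏ σ : G, (X - C (mobiusRatFunc (repG σ))) =
      C (algebraMap F[X] (RatFunc F) h) * (g.map (algebraMap F (RatFunc F)) -
        ∏ σ : G, (X - C (mobiusRatFunc (repG σ)))) -
      C (algebraMap F[X] (RatFunc F) g) * h.map (algebraMap F (RatFunc F)) := by ring
    rw [e, Finset.card_univ]
    have hgd : (g.map (algebraMap F (RatFunc F))).degree = (Fintype.card G : WithBot ℕ) := by
      rw [degree_map, degree_eq_natDegree hm.ne_zero, hcard']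
    refine (degree_sub_le _ _).trans_lt (max_lt ?_ ?_)
    · rw [degree_C_mul hh, ← hgd]
      apply degree_sub_lt_left (by rw [hgd, hprodd]) (hm.map _).ne_zero
      rw [(hm.map _).leadingCoeff, hprodm.leadingCoeff]
    · rw [degree_C_mul hg, degree_map, degree_eq_natDegree h0, ← hcard']
      exact_mod_cast hdeg
  · intro σ _
    have := hinv (repG σ) (by rw [repG_mk]; exact σ.2)
    have hne : aeval (mobiusRatFunc (repG σ)) h ≠ 0 := by
      intro e
      rw [e, div_zero] at this
      exact (div_ne_zero hg hh) this.symm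
    rw [div_eq_div_iff hne hh] at this
    rw [eval_mul (p := C _), eval_prod, Finset.prod_eq_zero (Finset.mem_univ σ) (by simp), mul_zero]
    simp only [eval_sub, eval_mul, eval_map_algebraMap, eval_C]
    rw [this]; ring

lemma key_poly (G : Subgroup (PGL2 F)) [Fintype G] (g h : F[X]) (hQ : IsQuotientMap G g h) :
    C (∏ σ : G, denP (repG σ)) * (g.map C * C h - h.map C * C g) =
      C h * ∏ σ : G, (C (denP (repG σ)) * X - C (numP (repG σ))) := by
  apply map_injective _ (IsFractionRing.injective F[X] (RatFunc F))
  have key := key_ratFunc G g h hQ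
  have hC : (algebraMap F[X] (RatFunc F)).comp C = algebraMap F (RatFunc F) := by
    ext; simp
  have e : ∀ σ : G, C (algebraMap F[X] (RatFunc F) (denP (repG σ))) * X -
      C (algebraMap F[X] (RatFunc F) (numP (repG σ))) =
      C (algebraMap F[X] (RatFunc F) (denP (repG σ))) * (X - C (mobiusRatFunc (repG σ))) := by
    intro σ
    have hd : algebraMap F[X] (RatFunc F) (denP (repG σ)) ≠ 0 :=
      fun e => den_ratFunc_ne (repG σ) (IsFractionRing.injective F[X] (RatFunc F) (by
        rw [map_zero]; exact e))
    rw [mul_sub, ← C_mul, mobius_eq_div, mul_div_cancel₀ _ hd]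
  simp only [Polynomial.map_mul, Polynomial.map_sub, map_C, Polynomial.map_prod, map_X,
    Polynomial.map_map, hC, e, key, Finset.prod_mul_distrib, map_prod]
  ring

variable {K : Type*} [Field K] [Algebra F K]

lemma key_eval (G : Subgroup (PGL2 F)) [Fintype G] (g h : F[X]) (hQ : IsQuotientMap G g h) (x : K) :
    C (∏ σ : G, aeval x (denP (repG σ))) *
      (g.map (algebraMap F K) * C (aeval x h) - h.map (algebraMap F K) * C (aeval x g)) =
      C (aeval x h) * ∏ σ : G, (C (aeval x (denP (repG σ))) * X - C (aeval x (numP (repG σ)))) := by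
  obtain ⟨φ, hφ⟩ : ∃ φ : F[X] →+* K, ∀ p, φ p = aeval x p := ⟨(aeval x : F[X] →ₐ[F] K), fun _ => rfl⟩
  have key := congrArg (Polynomial.map φ) (key_poly G g h hQ)
  have hC : φ.comp C = algebraMap F K := by
    ext; simp [hφ]
  simp only [Polynomial.map_mul, Polynomial.map_sub, map_C, Polynomial.map_prod, map_X,
    Polynomial.map_map, hC, hφ, map_prod] at key
  rw [map_prod]
  exact key

lemma not_both_zero {g h : F[X]} (hc : IsCoprime g h) (x : K) (h1 : aeval x g = 0)
    (h2 : aeval x h = 0) : False := by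
  obtain ⟨a, b, e⟩ := hc
  have := congrArg (aeval x) e
  simp [h1, h2] at this

lemma pole_den (G : Subgroup (PGL2 F)) [Fintype G] (g h : F[X]) (hQ : IsQuotientMap G g h) (x : K)
    (hx : aeval x h = 0) : ∃ σ : G, aeval x (denP (repG σ)) = 0 := by
  have key := key_eval G g h hQ x
  have hgx : aeval x g ≠ 0 := fun e => not_both_zero hQ.2.1 x e hx
  rw [hx] at key
  have hh : h.map (algebraMap F K) ≠ 0 := (Polynomial.map_ne_zero_iff (algebraMap F K).injective).2 hQ.2.2.1
  simp only [map_zero, mul_zero, zero_mul, zero_sub, mul_neg, neg_eq_zero, mul_eq_zero, hh, C_eq_zero,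
    hgx, or_false, Finset.prod_eq_zero_iff] at key
  simpa using key

lemma nonpole_den (G : Subgroup (PGL2 F)) [Fintype G] (g h : F[X]) (hQ : IsQuotientMap G g h) (x : K)
    (hx : aeval x h ≠ 0) (σ : G) : aeval x (denP (repG σ)) ≠ 0 := by
  intro e
  have key := key_eval G g h hQ x
  rw [Finset.prod_eq_zero (Finset.mem_univ σ) e, map_zero, zero_mul, eq_comm, mul_eq_zero,
    C_eq_zero, Finset.prod_eq_zero_iff] at key
  rcases key with key | ⟨τ, -, hτ⟩
  · exact hx key
  · have c0 := congrArg (fun p => coeff p 0) hτ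
    have c1 := congrArg (fun p => coeff p 1) hτ
    simp [numP, denP] at c0 c1
    apply det_ne (repG τ)
    apply (algebraMap F K).injective
    simp only [map_sub, map_mul, map_zero]
    have c0' : (algebraMap F K) ((repG τ).val 0 0) * x = - (algebraMap F K) ((repG τ).val 0 1) := by
      linear_combination -c0
    have c1' : (algebraMap F K) ((repG τ).val 1 1) = -(algebraMap F K) ((repG τ).val 1 0) * x := by
      linear_combination c1
    rw [c1']
    linear_combination (-(algebraMap F K) ((repG τ).val 1 0)) * c0'

lemma fiber (G : Subgroup (PGL2 F)) [Fintype G] (g h : F[X]) (hQ : IsQuotientMap G g h) (x : K)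
    (hx : aeval x h ≠ 0) : ∃ y : G → K, (∀ σ, MR K (repG σ) x (y σ)) ∧
      g.map (algebraMap F K) - C (aeval x g / aeval x h) * h.map (algebraMap F K) =
        ∏ σ : G, (X - C (y σ)) := by
  have hd := nonpole_den G g h hQ x hx
  refine ⟨fun σ => aeval x (numP (repG σ)) / aeval x (denP (repG σ)), ?_, ?_⟩
  · intro σ
    have := hd σ
    have e1 : aeval x (denP (repG σ)) = algebraMap F K ((repG σ).val 1 0) * x + algebraMap F K ((repG σ).val 1 1) := by
      simp [denP]
    have e2 : aeval x (numP (repG σ)) = algebraMap F K ((repG σ).val 0 0) * x + algebraMap F K ((repG σ).val 0 1) := by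
      simp [numP]
    unfold MR
    rw [← e1, ← e2]
    exact ⟨this, (mul_div_cancel₀ _ this).symm⟩
  · have key := key_eval G g h hQ x
    have e : ∀ σ : G, C (aeval x (denP (repG σ))) * X - C (aeval x (numP (repG σ))) =
      C (aeval x (denP (repG σ))) * (X - C (aeval x (numP (repG σ)) / aeval x (denP (repG σ)))) := by
      intro σ
      rw [mul_sub, ← C_mul, mul_div_cancel₀ _ (hd σ)]
    rw [Finset.prod_congr rfl fun σ _ => e σ, Finset.prod_mul_distrib, ← map_prod C] at key
    have hp : ∏ σ : G, aeval x (denP (repG σ)) ≠ 0 :=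
      Finset.prod_ne_zero_iff.2 fun σ _ => hd σ
    generalize (∏ σ : G, (X - C (aeval x (numP (repG σ)) / aeval x (denP (repG σ))))) = P at key ⊢
    generalize (∏ σ : G, aeval x (denP (repG σ))) = p at key hp
    generalize aeval x h = hx0 at *
    generalize aeval x g = gx0 at *
    have hp' : (C p : K[X]) ≠ 0 := by simpa using hp
    have hx' : (C hx0 : K[X]) ≠ 0 := by simpa using hx
    apply mul_left_cancel₀ hp'
    apply mul_left_cancel₀ hx'
    have e3 : (C hx0 : K[X]) * C (gx0 / hx0) = C gx0 := by rw [← C_mul, mul_div_cancel₀ _ hx]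
    linear_combination key - C p * h.map (algebraMap F K) * e3

end quot

section fin
variable {F : Type*} [Field F] {K : Type*} [Field K] [Algebra F K]

lemma homog_eval {L : Type*} [Field L] [Algebra F L] (f : F[X]) (u v : L) (hv : v ≠ 0) :
    ∑ i ∈ Finset.range (f.natDegree + 1), algebraMap F L (f.coeff i) * u ^ i * v ^ (f.natDegree - i)
      = v ^ f.natDegree * aeval (u / v) f := by
  rw [aeval_eq_sum_range, Finset.mul_sum]
  apply Finset.sum_congr rfl
  intro i hi
  have hi : i ≤ f.natDegree := by simpa [Nat.lt_succ_iff] using hi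
  rw [Algebra.smul_def, div_pow]
  obtain ⟨k, hk⟩ := Nat.exists_eq_add_of_le hi
  rw [hk, Nat.add_sub_cancel_left, pow_add]
  field_simp

lemma aeval_transform (g h f : F[X]) (x : K) (hx : aeval x h ≠ 0) :
    aeval x (ratTransform g h f) = aeval x h ^ f.natDegree * aeval (aeval x g / aeval x h) f := by
  rw [← homog_eval f _ _ hx]
  simp [ratTransform]

lemma aeval_transform_pole (g h f : F[X]) (hf : f.Monic) (x : K) (hx : aeval x h = 0) :
    aeval x (ratTransform g h f) = aeval x g ^ f.natDegree := by
  simp only [ratTransform, map_sum, map_mul, map_pow, hx, aeval_C]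
  rw [Finset.sum_range_succ, Finset.sum_eq_zero, hf.coeff_natDegree]
  · simp
  · intro i hi
    have : f.natDegree - i ≠ 0 := by have := Finset.mem_range.1 hi; omega
    rw [zero_pow this, mul_zero]

lemma map_transform [IsAlgClosed K] (g h f : F[X]) (hh : h ≠ 0) (hf : f.Monic) (hs : f.Separable) :
    (ratTransform g h f).map (algebraMap F K) =
      ∏ α ∈ f.rootSet_finite K |>.toFinset, (g.map (algebraMap F K) - C α * h.map (algebraMap F K)) := by
  classical
  apply IsFractionRing.injective K[X] (RatFunc K)
  have hh' : algebraMap K[X] (RatFunc K) (h.map (algebraMap F K)) ≠ 0 := by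
    intro e
    have := IsFractionRing.injective K[X] (RatFunc K) (e.trans (map_zero _).symm)
    exact hh ((Polynomial.map_eq_zero _).1 this)
  have hprod : f.map (algebraMap F K) = ∏ α ∈ f.rootSet_finite K |>.toFinset, (X - C α) := by
    have h1 := (IsAlgClosed.splits (f.map (algebraMap F K))).eq_prod_roots_of_monic (hf.map _)
    have h2 : (f.map (algebraMap F K)).roots.Nodup := nodup_roots hs.map
    have h3 : (f.rootSet_finite K).toFinset.val = (f.map (algebraMap F K)).roots := by
      have : (f.rootSet_finite K).toFinset = (f.map (algebraMap F K)).roots.toFinset := by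
        ext; simp [rootSet, aroots]
      rw [this, Multiset.toFinset_val, h2.dedup]
    rw [Finset.prod, h3]
    exact h1
  have hn : f.natDegree = (f.rootSet_finite K).toFinset.card := by
    have := congrArg natDegree hprod
    rw [natDegree_map, natDegree_prod_of_monic _ _ fun α _ => monic_X_sub_C α] at this
    simpa using this
  have e1 : algebraMap K[X] (RatFunc K) ((ratTransform g h f).map (algebraMap F K)) =
      algebraMap K[X] (RatFunc K) (h.map (algebraMap F K)) ^ (f.map (algebraMap F K)).natDegree *
      aeval (algebraMap K[X] (RatFunc K) (g.map (algebraMap F K)) /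
        algebraMap K[X] (RatFunc K) (h.map (algebraMap F K))) (f.map (algebraMap F K)) := by
    rw [← homog_eval _ _ _ hh', natDegree_map]
    simp only [ratTransform, Polynomial.map_sum, Polynomial.map_mul, Polynomial.map_pow, map_C,
      map_sum, map_mul, map_pow, coeff_map]
    rfl
  rw [e1, natDegree_map, hprod, hn, map_prod, map_prod, ← Finset.prod_const, ← Finset.prod_mul_distrib]
  apply Finset.prod_congr rfl
  intro α _
  have e2 : algebraMap K (RatFunc K) α = algebraMap K[X] (RatFunc K) (C α) := rfl
  simp only [map_sub, aeval_X, aeval_C, map_mul, e2]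
  rw [mul_sub, mul_div_cancel₀ _ hh', mul_comm]

variable [Fintype F]

lemma deg_dvd_iff [Algebra.IsAlgebraic F K] (x : K) (k : ℕ) :
    (minpoly F x).natDegree ∣ k ↔ (FiniteField.frobeniusAlgHom F K ^ k) x = x := by
  have hx : IsIntegral F x := Algebra.IsIntegral.isIntegral x
  rw [(minpoly.irreducible hx).natDegree_dvd_iff_dvd_X_pow_card_pow_sub_X, minpoly.dvd_iff]
  have : (FiniteField.frobeniusAlgHom F K ^ k) x = x ^ (Fintype.card F ^ k) := by
    rw [AlgHom.coe_pow, FiniteField.coe_frobeniusAlgHom, pow_iterate]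
  rw [this]
  simp [sub_eq_zero]

variable [IsAlgClosed K] [Algebra.IsAlgebraic F K]
  {G : Subgroup (PGL2 F)} {g h : F[X]}

lemma fib_monic (hQ : IsQuotientMap G g h) (α : K) :
    (g.map (algebraMap F K) - C α * h.map (algebraMap F K)).Monic ∧
    (g.map (algebraMap F K) - C α * h.map (algebraMap F K)).natDegree = Nat.card G := by
  obtain ⟨hm, hcop, h0, hdeg, hcard, hinv⟩ := hQ
  have hlt : (C α * h.map (algebraMap F K)).degree < (g.map (algebraMap F K)).degree := by
    rw [← smul_eq_C_mul]
    refine lt_of_le_of_lt (degree_smul_le _ _) ?_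
    rw [degree_map, degree_map]
    exact degree_lt_degree hdeg
  refine ⟨(hm.map _).sub_of_left hlt, ?_⟩
  rw [natDegree_eq_of_degree_eq (degree_sub_eq_left_of_degree_lt hlt), natDegree_map, hcard]

lemma sep_irr {f : F[X]} (hf : Irreducible f) : f.Separable :=
  PerfectField.separable_of_irreducible hf

lemma transform_monic (hQ : IsQuotientMap G g h) {f : F[X]} (hf : f.Monic) (hi : Irreducible f) :
    (ratTransform g h f).Monic ∧ (ratTransform g h f).natDegree = Nat.card G * f.natDegree := by
  have hm := map_transform (K := AlgebraicClosure F) g h f hQ.2.2.1 hf (sep_irr hi)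
  have hn : f.natDegree = (f.rootSet_finite (AlgebraicClosure F)).toFinset.card := by
    have := card_rootSet_eq_natDegree (K := AlgebraicClosure F) (sep_irr hi) (IsAlgClosed.splits _)
    rw [← this, ← Set.ncard_eq_toFinset_card _ (f.rootSet_finite (AlgebraicClosure F)), ← Nat.card_eq_fintype_card]
    rfl
  constructor
  · apply monic_of_injective (algebraMap F (AlgebraicClosure F)).injective
    rw [hm]
    exact monic_prod_of_monic _ _ fun α _ => (fib_monic hQ α).1
  · rw [← natDegree_map (algebraMap F (AlgebraicClosure F)), hm, natDegree_prod_of_monic _ _ fun α _ => (fib_monic hQ α).1]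
    rw [Finset.sum_congr rfl fun α _ => (fib_monic hQ α).2, Finset.sum_const, ← hn, smul_eq_mul, mul_comm]

lemma transform_sqf (hQ : IsQuotientMap G g h) {f : F[X]} (hf : f.Monic) (hi : Irreducible f) :
    Squarefree (ratTransform g h f) ↔ ∀ α : K, aeval α f = 0 →
      (g.map (algebraMap F K) - C α * h.map (algebraMap F K)).Separable := by
  have hm := map_transform (K := K) g h f hQ.2.2.1 hf (sep_irr hi)
  rw [← PerfectField.separable_iff_squarefree, ← separable_map (algebraMap F K), hm]
  constructor
  · intro hs α hα
    apply hs.of_dvd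
    apply Finset.dvd_prod_of_mem (fun α : K => g.map (algebraMap F K) - C α * h.map (algebraMap F K))
    simp [mem_rootSet, hα, hf.ne_zero]
  · intro hs
    apply separable_prod'
    · intro α _ β _ hne
      have hc : IsCoprime (g.map (algebraMap F K)) (h.map (algebraMap F K)) :=
        hQ.2.1.map (mapRingHom (algebraMap F K))
      have h1 : IsCoprime (g.map (algebraMap F K) - C α * h.map (algebraMap F K))
          (h.map (algebraMap F K)) := by
        have := IsCoprime.add_mul_right_left hc (-C α)
        rwa [neg_mul, ← sub_eq_add_neg] at this
      have hu : IsUnit (C (α - β) : K[X]) := isUnit_C.2 (sub_ne_zero.2 hne).isUnit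
      have h2 := (isCoprime_mul_unit_left_right hu _ _).2 h1
      have h3 := IsCoprime.add_mul_left_right h2 1
      have e : C (α - β) * h.map (algebraMap F K) +
          (g.map (algebraMap F K) - C α * h.map (algebraMap F K)) * 1 =
          g.map (algebraMap F K) - C β * h.map (algebraMap F K) := by
        rw [C_sub]; ring
      rwa [e] at h3
    · intro α hα
      apply hs
      rw [Set.Finite.mem_toFinset, mem_rootSet] at hα
      exact hα.2

lemma transform_root (hQ : IsQuotientMap G g h) {f : F[X]} (hf : f.Monic) (x : K) :
    aeval x (ratTransform g h f) = 0 ↔ aeval x h ≠ 0 ∧ aeval (aeval x g / aeval x h) f = 0 := by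
  by_cases hx : aeval x h = 0
  · rw [aeval_transform_pole g h f hf x hx]
    simp only [hx, ne_eq, not_true_eq_false, false_and, iff_false]
    exact pow_ne_zero _ fun e => not_both_zero hQ.2.1 x e hx
  · rw [aeval_transform g h f x hx]
    simp [hx]

lemma root_fib (hQ : IsQuotientMap G g h) (α x : K) :
    eval x (g.map (algebraMap F K) - C α * h.map (algebraMap F K)) = 0 ↔
      aeval x h ≠ 0 ∧ aeval x g / aeval x h = α := by
  simp only [eval_sub, eval_mul, eval_C, eval_map_algebraMap]
  constructor
  · intro e
    have hx : aeval x h ≠ 0 := by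
      intro hx
      rw [hx, mul_zero, sub_zero] at e
      exact not_both_zero hQ.2.1 x e hx
    exact ⟨hx, by rw [div_eq_iff hx]; linear_combination e⟩
  · rintro ⟨hx, rfl⟩
    rw [div_mul_cancel₀ _ hx, sub_self]

lemma transform_irr (hQ : IsQuotientMap G g h) (x : K) (hx : aeval x h ≠ 0) :
    Irreducible (ratTransform g h (minpoly F (aeval x g / aeval x h))) ↔
      (minpoly F x).natDegree = Nat.card G * (minpoly F (aeval x g / aeval x h)).natDegree := by
  have hi : ∀ z : K, IsIntegral F z := fun z => Algebra.IsIntegral.isIntegral z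
  set α := aeval x g / aeval x h with hα
  obtain ⟨hm, hd⟩ := transform_monic hQ (minpoly.monic (hi α)) (minpoly.irreducible (hi α))
  have hr : aeval x (ratTransform g h (minpoly F α)) = 0 :=
    (transform_root hQ (minpoly.monic (hi α)) x).2 ⟨hx, minpoly.aeval F α⟩
  rw [← hd]
  constructor
  · intro h1
    rw [← minpoly.eq_of_irreducible_of_monic h1 hr hm]
  · intro h1
    have : ratTransform g h (minpoly F α) = minpoly F x :=
      eq_of_monic_of_dvd_of_natDegree_le (minpoly.monic (hi x)) hm (minpoly.dvd F x hr) h1.ge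
    rw [this]
    exact minpoly.irreducible (hi x)

lemma fib_card (hQ : IsQuotientMap G g h) (α : K)
    (hs : Squarefree (ratTransform g h (minpoly F α))) :
    {x : K | aeval x h ≠ 0 ∧ aeval x g / aeval x h = α}.ncard = Nat.card G := by
  classical
  have hi : IsIntegral F α := Algebra.IsIntegral.isIntegral α
  have hsep := (transform_sqf hQ (minpoly.monic hi) (minpoly.irreducible hi)).1 hs α (minpoly.aeval F α)
  obtain ⟨hm, hd⟩ := fib_monic hQ α
  have : {x : K | aeval x h ≠ 0 ∧ aeval x g / aeval x h = α} =
    ((g.map (algebraMap F K) - C α * h.map (algebraMap F K)).roots.toFinset : Set K) := by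
    ext x
    simp only [Set.mem_ofPred_eq, Multiset.mem_toFinset, Finset.mem_coe, mem_roots hm.ne_zero, IsRoot.def]
    exact (root_fib hQ α x).symm
  rw [this, Set.ncard_coe_finset, Multiset.toFinset_card_of_nodup (nodup_roots hsep),
    ← (IsAlgClosed.splits _).natDegree_eq_card_roots, hd]

lemma deg_cases (hQ : IsQuotientMap G g h) [Fintype G] (hp : (Nat.card G).Prime)
    (x : K) (hx : aeval x h ≠ 0) :
    (minpoly F x).natDegree = (minpoly F (aeval x g / aeval x h)).natDegree ∨
    (minpoly F x).natDegree = Nat.card G * (minpoly F (aeval x g / aeval x h)).natDegree := by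
  set α := aeval x g / aeval x h with hα
  obtain ⟨y, hy, hprod⟩ := fiber G g h hQ x hx
  have hr := (root_fib hQ α x).2 ⟨hx, rfl⟩
  set m := (minpoly F α).natDegree with hm
  have hψα := (deg_dvd_iff α m).1 dvd_rfl
  set ψ := FiniteField.frobeniusAlgHom F K ^ m with hψ
  have h1 : m ∣ (minpoly F x).natDegree := by
    rw [hm, deg_dvd_iff, hα, map_div₀, ← aeval_algHom_apply, ← aeval_algHom_apply,
      (deg_dvd_iff x _).1 dvd_rfl]
  have h2 : (minpoly F x).natDegree ∣ m * Nat.card G := by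
    have hr2 : eval (ψ x) (g.map (algebraMap F K) - C α * h.map (algebraMap F K)) = 0 := by
      simp only [eval_sub, eval_mul, eval_C, eval_map_algebraMap] at hr ⊢
      have := congrArg ψ hr
      rw [map_sub, map_mul, hψα, ← aeval_algHom_apply, ← aeval_algHom_apply, map_zero] at this
      exact this
    rw [hprod, eval_prod, Finset.prod_eq_zero_iff] at hr2
    obtain ⟨σ, -, hσ⟩ := hr2
    have hσ : ψ x = y σ := by simpa [sub_eq_zero] using hσ
    have h3 := hy σ
    rw [← hσ] at h3
    have h4 := h3.iterate ψ (Nat.card G)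
    have h5 : repG σ ^ Nat.card G ∈ Subgroup.center (GL (Fin 2) F) := by
      rw [← QuotientGroup.eq_one_iff, QuotientGroup.mk_pow]
      have := repG_mk σ
      unfold PGL2.mk at this
      rw [this, ← Subgroup.coe_pow, pow_card_eq_one', Subgroup.coe_one]
    have h6 := h4.unique (MR.central h5 x)
    rw [deg_dvd_iff, pow_mul]
    exact h6
  obtain ⟨k, hk⟩ := h1
  have hmpos : 0 < m := minpoly.natDegree_pos (Algebra.IsIntegral.isIntegral α)
  rw [hk] at h2 ⊢
  rcases (Nat.dvd_prime hp).1 (Nat.dvd_of_mul_dvd_mul_left hmpos h2) with rfl | rfl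
  · left; simp
  · right; ring

end fin

section final
variable {F : Type*} [Field F] [Fintype F] {K : Type*} [Field K] [Algebra F K]
  [IsAlgClosed K] [Algebra.IsAlgebraic F K]
  {G : Subgroup (PGL2 F)} {g h : F[X]}

lemma bdd_set (hQ : IsQuotientMap G g h) [Fintype G] (hp : (Nat.card G).Prime) :
    BddAbove {n : ℕ | ∃ f : F[X], f.Monic ∧ Irreducible f ∧ f.natDegree = n ∧
    ¬ Squarefree (ratTransform g h f)} := by
  let L := AlgebraicClosure F
  let Sx : Set L := ⋃ p : {p : G × G // p.1 ≠ p.2}, (quadPoly (repG p.1.1) (repG p.1.2)).rootSet L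
  have hfin : Sx.Finite := Set.finite_iUnion fun p => rootSet_finite _ _
  refine ((hfin.image fun x => (minpoly F (aeval x g / aeval x h)).natDegree).subset ?_).bddAbove
  rintro n ⟨f, hf, hi, rfl, hns⟩
  rw [transform_sqf (K := L) hQ hf hi] at hns
  push Not at hns
  obtain ⟨α, hα, hns⟩ := hns
  obtain ⟨hm, hd⟩ := fib_monic hQ α
  obtain ⟨x, hx⟩ := IsAlgClosed.exists_root (g.map (algebraMap F L) - C α * h.map (algebraMap F L))
    (by rw [degree_eq_natDegree hm.ne_zero, hd]; exact_mod_cast hp.ne_zero)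
  obtain ⟨hx0, hxα⟩ := (root_fib hQ α x).1 hx
  obtain ⟨y, hy, hprod⟩ := fiber G g h hQ x hx0
  rw [hxα] at hprod
  rw [hprod, separable_prod_X_sub_C_iff] at hns
  simp only [Function.Injective] at hns
  push Not at hns
  obtain ⟨σ, τ, he, hne⟩ := hns
  refine ⟨x, ?_, ?_⟩
  · refine Set.mem_iUnion.2 ⟨⟨(σ, τ), hne⟩, ?_⟩
    rw [mem_rootSet]
    refine ⟨fun e => hne ?_, ?_⟩
    · have := mk_eq_of_quadPoly e
      rw [repG_mk, repG_mk] at this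
      exact Subtype.ext this
    · have h1 := hy σ
      rw [he] at h1
      exact h1.quad (hy τ)
  · simp only [hxα]
    rw [← minpoly.eq_of_irreducible_of_monic hi hα hf]

lemma sqf_of_lt (hQ : IsQuotientMap G g h) [Fintype G] (hp : (Nat.card G).Prime) {f : F[X]}
    (hf : f.Monic) (hi : Irreducible f) (hn : dval g h < f.natDegree) :
    Squarefree (ratTransform g h f) := by
  by_contra hc
  exact absurd (le_csSup (bdd_set hQ hp) ⟨f, hf, hi, rfl, hc⟩) (not_le.2 hn)

lemma nonpole_of_lt (hQ : IsQuotientMap G g h) [Fintype G] (hp : (Nat.card G).Prime) (x : K)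
    (hn : dval g h < (minpoly F x).natDegree) : aeval x h ≠ 0 := by
  intro hx
  obtain ⟨σ, hσ⟩ := pole_den G g h hQ x hx
  set B := repG σ with hB
  have hdet := det_ne B
  have hσ' : algebraMap F K (B.val 1 0) * x + algebraMap F K (B.val 1 1) = 0 := by
    simpa [denP] using hσ
  have hc : B.val 1 0 ≠ 0 := by
    intro hc
    rw [hc, map_zero, zero_mul, zero_add] at hσ'
    have : B.val 1 1 = 0 := (algebraMap F K).injective (by rw [hσ', map_zero])
    apply hdet
    rw [hc, this]; ring
  have hc' : algebraMap F K (B.val 1 0) ≠ 0 := by simpa using hc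
  have hx1 : x = algebraMap F K (-(B.val 1 1) / B.val 1 0) := by
    rw [map_div₀, map_neg, eq_div_iff hc']
    linear_combination hσ'
  have hdx : (minpoly F x).natDegree = 1 := by
    rw [hx1, minpoly.eq_X_sub_C, natDegree_X_sub_C]
  have hσ1 : σ ≠ 1 := by
    rintro rfl
    have : B ∈ Subgroup.center (GL (Fin 2) F) := by
      rw [← QuotientGroup.eq_one_iff]
      exact repG_mk (1 : G)
    exact hc (central_entries this).2.1
  -- fixed point
  obtain ⟨y, hy⟩ := IsAlgClosed.exists_aeval_eq_zero K
    (C (B.val 1 0) * X ^ 2 + C (B.val 1 1 - B.val 0 0) * X + C (- B.val 0 1))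
    (by rw [degree_quadratic hc]; decide)
  have hy' : algebraMap F K (B.val 0 0) * y + algebraMap F K (B.val 0 1) =
    (algebraMap F K (B.val 1 0) * y + algebraMap F K (B.val 1 1)) * y := by
    simp only [map_add, map_mul, map_pow, aeval_X, aeval_C, map_sub, map_neg] at hy
    linear_combination -hy
  have hMR : MR K B y y := by
    refine ⟨fun e => ?_, hy'⟩
    rw [e, zero_mul] at hy'
    apply hdet
    apply (algebraMap F K).injective
    simp only [map_sub, map_mul, map_zero]
    linear_combination algebraMap F K (B.val 0 0) * e - algebraMap F K (B.val 1 0) * hy'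
  have hypole : aeval y h ≠ 0 := by
    intro hy0
    obtain ⟨τ, hτ⟩ := pole_den G g h hQ y hy0
    haveI : Fact (Nat.card G).Prime := ⟨hp⟩
    obtain ⟨k, hk⟩ := mem_powers_of_prime_card (G := G) (g' := τ) rfl hσ1
    have h1 : MR K (B ^ k) y y := by
      simpa using MR.iterate (AlgHom.id F K) (x := y) (B := B) hMR k
    have hz : (B ^ k)⁻¹ * repG τ ∈ Subgroup.center (GL (Fin 2) F) := by
      apply QuotientGroup.eq.1
      rw [QuotientGroup.mk_pow]
      have e1 := repG_mk σ
      have e2 := repG_mk τ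
      unfold PGL2.mk at e1 e2
      rw [hB, e1, e2, ← hk]
      rfl
    have h2 := (MR.central hz y).comp h1
    rw [mul_inv_cancel_left] at h2
    apply h2.1
    simpa [denP] using hτ
  set α := aeval y g / aeval y h with hα
  have hiα : IsIntegral F α := Algebra.IsIntegral.isIntegral α
  have hnsq : ¬ Squarefree (ratTransform g h (minpoly F α)) := by
    rw [transform_sqf (K := K) hQ (minpoly.monic hiα) (minpoly.irreducible hiα)]
    intro hs
    have hs := hs α (minpoly.aeval F α)
    obtain ⟨z, hz, hprod⟩ := fiber G g h hQ y hypole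
    rw [hprod, separable_prod_X_sub_C_iff] at hs
    apply hσ1
    apply hs
    rw [(hz σ).unique hMR]
    refine ((hz 1).unique (MR.central ?_ y)).symm
    rw [← QuotientGroup.eq_one_iff]
    exact repG_mk (1 : G)
  have := le_csSup (bdd_set hQ hp) ⟨minpoly F α, minpoly.monic hiα, minpoly.irreducible hiα, rfl, hnsq⟩
  have h3 := minpoly.natDegree_pos hiα
  have h4 : (minpoly F α).natDegree ≤ dval g h := this
  omega

lemma ncard_fiber {α β : Type*} (f : α → β) (S : Set α) (T : Set β) (hS : S.Finite) (k : ℕ)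
    (hk : 0 < k) (hmap : ∀ x ∈ S, f x ∈ T) (hfib : ∀ t ∈ T, {x | x ∈ S ∧ f x = t}.ncard = k) :
    S.ncard = k * T.ncard := by
  classical
  have hT : T.Finite := by
    refine (hS.image f).subset fun t ht => ?_
    have : {x | x ∈ S ∧ f x = t}.Nonempty := by
      apply Set.nonempty_of_ncard_ne_zero
      rw [hfib t ht]; omega
    obtain ⟨x, hx, hxt⟩ := this
    exact ⟨x, hx, hxt⟩
  rw [Set.ncard_eq_toFinset_card _ hS, Set.ncard_eq_toFinset_card _ hT]
  rw [Finset.card_eq_sum_card_fiberwise (f := f) (t := hT.toFinset) (by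
    intro x hx; simpa using hmap x (by simpa using hx))]
  rw [Finset.sum_congr rfl (g := fun _ => k), Finset.sum_const, smul_eq_mul, mul_comm]
  intro t ht
  rw [← hfib t (by simpa using ht), ← Set.ncard_coe_finset]
  congr 1
  ext x; simp

lemma degset_finite (n : ℕ) (hn : 0 < n) : {x : K | (minpoly F x).natDegree = n}.Finite := by
  have h1 : (X ^ (Fintype.card F) ^ n - X : F[X]) ≠ 0 :=
    FiniteField.X_pow_card_pow_sub_X_ne_zero _ hn.ne' Fintype.one_lt_card
  refine (rootSet_finite (X ^ (Fintype.card F) ^ n - X : F[X]) K).subset ?_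
  intro x hx
  rw [mem_rootSet]
  refine ⟨h1, ?_⟩
  have hx : (minpoly F x).natDegree = n := hx
  have := (deg_dvd_iff x n).1 hx.dvd
  rw [AlgHom.coe_pow, FiniteField.coe_frobeniusAlgHom, pow_iterate] at this
  simpa [sub_eq_zero] using this

variable (K) in
lemma count_poly (P : F[X] → Prop) (n : ℕ) (hn : 0 < n) :
    {x : K | (minpoly F x).natDegree = n ∧ P (minpoly F x)}.ncard =
      n * {f : F[X] | f.Monic ∧ Irreducible f ∧ f.natDegree = n ∧ P f}.ncard := by
  have hi : ∀ z : K, IsIntegral F z := fun z => Algebra.IsIntegral.isIntegral z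
  apply ncard_fiber (fun x => minpoly F x) _ _ ((degset_finite n hn).subset fun x hx => hx.1) n hn
  · rintro x ⟨h1, h2⟩
    exact ⟨minpoly.monic (hi x), minpoly.irreducible (hi x), h1, h2⟩
  · rintro f ⟨h1, h2, h3, h4⟩
    have e : {x : K | x ∈ {x : K | (minpoly F x).natDegree = n ∧ P (minpoly F x)} ∧ minpoly F x = f} =
        f.rootSet K := by
      ext x
      rw [mem_rootSet]
      constructor
      · rintro ⟨_, rfl⟩
        exact ⟨h1.ne_zero, minpoly.aeval F x⟩
      · rintro ⟨_, hx⟩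
        have := (minpoly.eq_of_irreducible_of_monic h2 hx h1).symm
        refine ⟨?_, this⟩
        show _ ∧ _
        rw [this]; exact ⟨h3, h4⟩
    have := card_rootSet_eq_natDegree (K := K) (sep_irr h2) (IsAlgClosed.splits _)
    rw [e, ← h3, ← this, ← Nat.card_eq_fintype_card]
    rfl

end final

theorem transform_count_recursion (F : Type*) [Field F] [Fintype F]
    (G : Subgroup (PGL2 F)) (s : ℕ) (hs : s.Prime) (hG : Nat.card G = s)
    (hcyc : IsCyclic ↥G) (g h : F[X]) (hQ : IsQuotientMap G g h)
    (n : ℕ) (hn : dval g h < n) :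
    ((transformIrredSet g h n).ncard : ℤ)
        - (s - 1) * ((transformRedSet g h n).ncard : ℤ)
      = if s ∣ n then ((transformIrredSet g h (n / s)).ncard : ℤ) else 0 := by
  classical
  subst hG
  haveI : Finite G := Nat.finite_of_card_ne_zero hs.ne_zero
  letI : Fintype G := Fintype.ofFinite G
  have hn0 : 0 < n := by omega
  let K := AlgebraicClosure F
  have hi : ∀ z : K, IsIntegral F z := fun z => Algebra.IsIntegral.isIntegral z
  let P : F[X] → Prop := fun f => Irreducible (ratTransform g h f)
  let Q : K → K := fun x => aeval x g / aeval x h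
  have hC : ∀ m, 0 < m → {x : K | (minpoly F x).natDegree = m ∧ P (minpoly F x)}.ncard =
      m * (transformIrredSet g h m).ncard := fun m hm => count_poly K P m hm
  have hD : {x : K | (minpoly F x).natDegree = n ∧ ¬ P (minpoly F x)}.ncard =
      n * (transformRedSet g h n).ncard := count_poly K (fun f => ¬ P f) n hn0
  set S : Set K := {x : K | (minpoly F x).natDegree = n} with hSdef
  have hS : S.Finite := degset_finite n hn0
  have hnp : ∀ x ∈ S, aeval x h ≠ 0 := fun x hx =>
    nonpole_of_lt hQ hs x (by rw [show (minpoly F x).natDegree = n from hx]; exact hn)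
  have hsplit : ∀ p : K → Prop, S.ncard = {x : K | x ∈ S ∧ p x}.ncard + {x : K | x ∈ S ∧ ¬ p x}.ncard := by
    intro p
    rw [← Set.ncard_union_eq _ (hS.subset fun x hx => hx.1) (hS.subset fun x hx => hx.1)]
    · congr 1
      ext x
      constructor
      · intro hx
        by_cases hpx : p x
        · exact Or.inl ⟨hx, hpx⟩
        · exact Or.inr ⟨hx, hpx⟩
      · rintro (hx | hx) <;> exact hx.1
    · rw [Set.disjoint_left]
      intro x h1 h2
      exact h2.2 h1.2
  have hs1 : S.ncard = n * (transformIrredSet g h n).ncard + n * (transformRedSet g h n).ncard := by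
    rw [← hC n hn0, ← hD]
    exact hsplit fun x => P (minpoly F x)
  have hs2 := hsplit fun x => (minpoly F (Q x)).natDegree = n
  have hA : {x : K | x ∈ S ∧ (minpoly F (Q x)).natDegree = n}.ncard =
      Nat.card G * (n * (transformRedSet g h n).ncard) := by
    rw [← hD]
    apply ncard_fiber Q _ _ (hS.subset fun x hx => hx.1) _ hs.pos
    · rintro x ⟨hx, hx2⟩
      refine ⟨hx2, ?_⟩
      intro hP
      have h1 := (transform_irr hQ x (hnp x hx)).1 hP
      have hx : (minpoly F x).natDegree = n := hx
      have hx2 : (minpoly F (aeval x g / aeval x h)).natDegree = n := hx2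
      rw [hx, hx2] at h1
      have := hs.two_le
      nlinarith
    · rintro α ⟨hα, hαP⟩
      have hsq := sqf_of_lt hQ hs (minpoly.monic (hi α)) (minpoly.irreducible (hi α)) (by rw [hα]; exact hn)
      refine Eq.trans ?_ (fib_card hQ α hsq)
      congr 1
      ext x
      constructor
      · rintro ⟨hx, hx2⟩
        exact ⟨hnp x hx.1, hx2⟩
      · rintro ⟨hx, hx2⟩
        subst hx2
        refine ⟨⟨?_, hα⟩, rfl⟩
        rcases deg_cases hQ hs x hx with h1 | h1
        · exact h1.trans hα
        · exact absurd ((transform_irr hQ x hx).2 h1) hαP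
  have hB : ∀ x, x ∈ S ∧ ¬ (minpoly F (Q x)).natDegree = n →
      n = Nat.card G * (minpoly F (Q x)).natDegree := by
    rintro x ⟨hx, hx2⟩
    rcases deg_cases hQ hs x (hnp x hx) with h1 | h1
    · exact absurd (h1.symm.trans hx) hx2
    · exact hx.symm.trans h1
  have hnZ : (n : ℤ) ≠ 0 := by exact_mod_cast hn0.ne'
  split_ifs with hdvd
  · obtain ⟨m, rfl⟩ := hdvd
    rw [Nat.mul_div_cancel_left _ hs.pos]
    have hm0 : 0 < m := Nat.pos_of_mul_pos_left hn0
    have hE : {x : K | x ∈ S ∧ ¬ (minpoly F (Q x)).natDegree = Nat.card G * m}.ncard =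
        Nat.card G * (m * (transformIrredSet g h m).ncard) := by
      rw [← hC m hm0]
      apply ncard_fiber Q _ _ (hS.subset fun x hx => hx.1) _ hs.pos
      · intro x hx
        have h1 := Nat.eq_of_mul_eq_mul_left hs.pos (hB x hx)
        refine ⟨h1.symm, (transform_irr hQ x (hnp x hx.1)).2 ?_⟩
        exact (show (minpoly F x).natDegree = _ from hx.1).trans (by rw [h1])
      · rintro α ⟨hα, hαP⟩
        have hsq : Squarefree (ratTransform g h (minpoly F α)) :=  hαP.squarefree
        refine Eq.trans ?_ (fib_card hQ α hsq)
        congr 1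
        ext x
        constructor
        · rintro ⟨hx, hx2⟩
          exact ⟨hnp x hx.1, hx2⟩
        · rintro ⟨hx, hx2⟩
          subst hx2
          refine ⟨⟨?_, ?_⟩, rfl⟩
          · show _ = _
            rw [(transform_irr hQ x hx).1 hαP, hα]
          · intro h1
            have h1 := hα.symm.trans h1
            have := hs.two_le
            nlinarith
    rw [hs1, hA, hE] at hs2
    have hs3 := congrArg (Nat.cast : ℕ → ℤ) hs2
    push_cast at hs3 hnZ
    apply mul_left_cancel₀ hnZ
    linear_combination hs3
  · have hE : {x : K | x ∈ S ∧ ¬ (minpoly F (Q x)).natDegree = n} = ∅ := by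
      rw [Set.eq_empty_iff_forall_notMem]
      intro x hx
      exact hdvd ⟨_, hB x hx⟩
    rw [hs1, hA, hE, Set.ncard_empty] at hs2
    have hs3 := congrArg (Nat.cast : ℕ → ℤ) hs2
    push_cast at hs3
    apply mul_left_cancel₀ hnZ
    linear_combination hs3
end

section
/- Let F_q be a finite field and G ≤ PGL_2(F_q) a subgroup. For every integer m > d(G), the number N_q(m) of monic irreducible polynomials of degree m over F_q satisfies N_q(m) = Σ_{k | |G|} ω_G(m·|G|/k, k), where the sum runs over all positive divisors k of |G|. -/
open Polynomial

/-- The (non-normalized) Möbius substitution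
`Σ_{i=0}^{deg f} f_i (ax+b)^i (cx+d)^{deg f - i}` of `f` by `A ∈ GL₂(F)`. -/
noncomputable def mobiusSubst {F : Type*} [Field F] (A : GL (Fin 2) F) (f : F[X]) : F[X] :=
  ∑ i ∈ Finset.range (f.natDegree + 1),
    C (f.coeff i) * (C (A.val 0 0) * X + C (A.val 0 1)) ^ i *
      (C (A.val 1 0) * X + C (A.val 1 1)) ^ (f.natDegree - i)

/-- `[A] ∗ f`: the unique monic scalar multiple of the Möbius substitution of `f`
by `A`. -/
noncomputable def mobiusStar {F : Type*} [Field F] (A : GL (Fin 2) F) (f : F[X]) : F[X] :=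
  C ((mobiusSubst A f).leadingCoeff)⁻¹ * mobiusSubst A f

/-- `f ∈ NR_q^G`: `f` is monic and has no root in the `G`-orbit of `∞` under the
Möbius action (the orbit point `[A] ∘ ∞` is `a/c` when `c ≠ 0`, and `∞` — which is
never a root of a monic polynomial — when `c = 0`). -/
def memNR {F : Type*} [Field F] (G : Subgroup (PGL2 F)) (f : F[X]) : Prop :=
  f.Monic ∧ ∀ A : GL (Fin 2) F, PGL2.mk A ∈ G → A.val 1 0 ≠ 0 →
    f.eval (A.val 0 0 / A.val 1 0) ≠ 0

/-- `G ∗ r`: the `G`-orbit of the polynomial `r` under the `∗` action. -/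
def polyOrbit {F : Type*} [Field F] (G : Subgroup (PGL2 F)) (r : F[X]) : Set F[X] :=
  {t : F[X] | ∃ A : GL (Fin 2) F, PGL2.mk A ∈ G ∧ t = mobiusStar A r}

/-- `ω_G(n, k)`: the number of `G`-orbits of size `k` of monic irreducible
polynomials of degree `n` in `NR_q^G`. -/
noncomputable def omegaG {F : Type*} [Field F] (G : Subgroup (PGL2 F)) (n k : ℕ) : ℕ :=
  {O : Set F[X] | ∃ r : F[X], memNR G r ∧ Irreducible r ∧ r.natDegree = n ∧
    O = polyOrbit G r ∧ O.ncard = k}.ncard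

namespace CI

open Polynomial

noncomputable def nm {F : Type*} [Field F] (A : GL (Fin 2) F) : F[X] :=
  C (A.val 0 0) * X + C (A.val 0 1)

noncomputable def dn {F : Type*} [Field F] (A : GL (Fin 2) F) : F[X] :=
  C (A.val 1 0) * X + C (A.val 1 1)

noncomputable def mob {F : Type*} [Field F] {L : Type*} [Field L] [Algebra F L]
    (A : GL (Fin 2) F) (x : L) : L := aeval x (nm A) / aeval x (dn A)

section basic
variable {F : Type*} [Field F]

lemma det_ne (A : GL (Fin 2) F) :
    A.val 0 0 * A.val 1 1 - A.val 0 1 * A.val 1 0 ≠ 0 := by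
  have h := A.isUnit.map Matrix.detMonoidHom
  have h2 := h.ne_zero
  simpa [Matrix.det_fin_two] using h2

lemma inv_entries (A : GL (Fin 2) F) : ∃ z : F, z ≠ 0 ∧
    (A⁻¹).val 0 0 = z * A.val 1 1 ∧ (A⁻¹).val 0 1 = - (z * A.val 0 1) ∧
    (A⁻¹).val 1 0 = - (z * A.val 1 0) ∧ (A⁻¹).val 1 1 = z * A.val 0 0 := by
  refine ⟨(A.val 0 0 * A.val 1 1 - A.val 0 1 * A.val 1 0)⁻¹, inv_ne_zero (det_ne A), ?_⟩
  have h : (A⁻¹).val = (A.val)⁻¹ := by simp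
  rw [h, Matrix.inv_def, Matrix.adjugate_fin_two, Matrix.det_fin_two, Ring.inverse_eq_inv']
  simp

lemma mk_eq_of_smul (A B : GL (Fin 2) F) (z : F) (h : ∀ i j, B.val i j = z * A.val i j) :
    PGL2.mk A = PGL2.mk B := by
  rw [QuotientGroup.eq, Matrix.GeneralLinearGroup.mem_center_iff_val_mem_range_scalar]
  refine ⟨z, ?_⟩
  have hB : B.val = Matrix.scalar (Fin 2) z * A.val := by
    ext i j
    rw [h]; simp [Matrix.scalar_apply, Matrix.diagonal_mul]
  have : (A⁻¹ * B).val = (A⁻¹).val * B.val := rfl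
  have hc : Matrix.scalar (Fin 2) z * A.val = A.val * Matrix.scalar (Fin 2) z :=
    Matrix.scalar_comm z (fun r => Commute.all _ _) _
  rw [this, hB, hc, ← mul_assoc, ← Units.val_mul]
  simp

lemma smul_of_mk_eq (A B : GL (Fin 2) F) (h : PGL2.mk A = PGL2.mk B) :
    ∃ z : F, z ≠ 0 ∧ ∀ i j, B.val i j = z * A.val i j := by
  rw [QuotientGroup.eq, Matrix.GeneralLinearGroup.mem_center_iff_val_mem_range_scalar] at h
  obtain ⟨z, hz⟩ := h
  have hB : B.val = A.val * Matrix.scalar (Fin 2) z := by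
    rw [hz, ← Units.val_mul]; simp
  have he : ∀ i j, B.val i j = z * A.val i j := by
    intro i j
    rw [hB]; simp [Matrix.scalar_apply, Matrix.mul_diagonal, mul_comm]
  refine ⟨z, ?_, he⟩
  rintro rfl
  apply det_ne B
  simp [he]

lemma mk_eq_of_coeff (A B : GL (Fin 2) F)
    (h1 : A.val 0 0 * B.val 1 0 = B.val 0 0 * A.val 1 0)
    (h2 : A.val 0 0 * B.val 1 1 + A.val 0 1 * B.val 1 0 =
      B.val 0 0 * A.val 1 1 + B.val 0 1 * A.val 1 0)
    (h3 : A.val 0 1 * B.val 1 1 = B.val 0 1 * A.val 1 1) : PGL2.mk A = PGL2.mk B := by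
  have hd := det_ne A
  apply mk_eq_of_smul A B ((A.val 1 1 * B.val 0 0 - A.val 0 1 * B.val 1 0) /
    (A.val 0 0 * A.val 1 1 - A.val 0 1 * A.val 1 0))
  intro i j
  rw [div_mul_eq_mul_div, eq_div_iff hd]
  fin_cases i <;> fin_cases j <;> simp only [Fin.zero_eta, Fin.mk_one]
  · linear_combination (A.val 0 1) * h1
  · linear_combination (A.val 0 1) * h2 - A.val 0 0 * h3
  · linear_combination (A.val 1 1) * h1
  · linear_combination (A.val 1 1) * h2 - A.val 1 0 * h3

variable {L : Type*} [Field L] [Algebra F L]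

lemma aeval_nm (A : GL (Fin 2) F) (x : L) :
    aeval x (nm A) = algebraMap F L (A.val 0 0) * x + algebraMap F L (A.val 0 1) := by
  simp [nm]

lemma aeval_dn (A : GL (Fin 2) F) (x : L) :
    aeval x (dn A) = algebraMap F L (A.val 1 0) * x + algebraMap F L (A.val 1 1) := by
  simp [dn]

lemma nm_ne_of_dn (A : GL (Fin 2) F) (x : L) (h : aeval x (dn A) = 0) : aeval x (nm A) ≠ 0 := by
  intro h'
  rw [aeval_nm] at h'
  rw [aeval_dn] at h
  apply det_ne A
  apply (algebraMap F L).injective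
  simp only [map_sub, map_mul, map_zero]
  by_cases hc : algebraMap F L (A.val 1 0) = 0
  · rw [hc] at h ⊢
    have : algebraMap F L (A.val 1 1) = 0 := by linear_combination h
    rw [this]; ring
  · apply mul_left_cancel₀ hc
    linear_combination algebraMap F L (A.val 1 0) * (algebraMap F L (A.val 0 0) * h - algebraMap F L (A.val 1 0) * h')

lemma dn_smul (A B : GL (Fin 2) F) (z : F) (h : ∀ i j, B.val i j = z * A.val i j) (x : L) :
    aeval x (dn B) = algebraMap F L z * aeval x (dn A) := by
  rw [aeval_dn, aeval_dn, h, h]; simp; ring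

lemma nm_smul (A B : GL (Fin 2) F) (z : F) (h : ∀ i j, B.val i j = z * A.val i j) (x : L) :
    aeval x (nm B) = algebraMap F L z * aeval x (nm A) := by
  rw [aeval_nm, aeval_nm, h, h]; simp; ring

lemma mob_congr (A B : GL (Fin 2) F) (h : PGL2.mk A = PGL2.mk B) (x : L) :
    mob A x = mob B x := by
  obtain ⟨z, hz, he⟩ := smul_of_mk_eq A B h
  have : algebraMap F L z ≠ 0 := by simpa using hz
  rw [mob, mob, dn_smul A B z he, nm_smul A B z he, mul_div_mul_left _ _ this]

lemma dn_congr (A B : GL (Fin 2) F) (h : PGL2.mk A = PGL2.mk B) (x : L)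
    (hA : aeval x (dn A) ≠ 0) : aeval x (dn B) ≠ 0 := by
  obtain ⟨z, hz, he⟩ := smul_of_mk_eq A B h
  have : algebraMap F L z ≠ 0 := by simpa using hz
  rw [dn_smul A B z he]
  exact mul_ne_zero this hA

/-- inverse -/
lemma mob_inv (A : GL (Fin 2) F) (x : L) (h : aeval x (dn A) ≠ 0) :
    aeval (mob A x) (dn A⁻¹) ≠ 0 ∧ mob A⁻¹ (mob A x) = x := by
  obtain ⟨z, hz, h00, h01, h10, h11⟩ := inv_entries A
  have hz' : algebraMap F L z ≠ 0 := by simpa using hz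
  have hd : algebraMap F L (A.val 0 0) * algebraMap F L (A.val 1 1) -
      algebraMap F L (A.val 0 1) * algebraMap F L (A.val 1 0) ≠ 0 := by
    have := det_ne A
    rw [← map_mul, ← map_mul, ← map_sub]
    exact (_root_.map_ne_zero _).2 this
  set y := mob A x with hy
  have hy1 : y * aeval x (dn A) = aeval x (nm A) := by
    rw [hy, mob, div_mul_cancel₀ _ h]
  rw [aeval_dn] at hy1 h
  rw [aeval_nm] at hy1
  have hne : aeval y (dn A⁻¹) ≠ 0 := by
    rw [aeval_dn, h10, h11]
    simp only [map_neg, map_mul]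
    intro h0
    have h0' : algebraMap F L (A.val 0 0) - algebraMap F L (A.val 1 0) * y = 0 := by
      apply mul_left_cancel₀ hz'
      linear_combination h0
    apply hd
    linear_combination algebraMap F L (A.val 1 0) * hy1 +
      (algebraMap F L (A.val 1 0) * x + algebraMap F L (A.val 1 1)) * h0'
  refine ⟨hne, ?_⟩
  rw [mob, div_eq_iff hne, aeval_nm, aeval_dn, h00, h01, h10, h11]
  simp only [map_neg, map_mul]
  linear_combination algebraMap F L z * hy1

lemma mob_inj (A B : GL (Fin 2) F) (x : L) (hx : ∀ p : F[X], p.natDegree ≤ 2 → aeval x p = 0 → p = 0)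
    (hA : aeval x (dn A) ≠ 0) (hB : aeval x (dn B) ≠ 0) (h : mob A x = mob B x) :
    PGL2.mk A = PGL2.mk B := by
  rw [mob, mob, div_eq_div_iff hA hB, ← map_mul, ← map_mul] at h
  have h0 : nm A * dn B - nm B * dn A = 0 := by
    apply hx
    · rw [nm, nm, dn, dn]
      compute_degree
    · rw [map_sub, h, sub_self]
  have e : nm A * dn B - nm B * dn A =
    C (A.val 0 0 * B.val 1 0 - B.val 0 0 * A.val 1 0) * X ^ 2 +
    C (A.val 0 0 * B.val 1 1 + A.val 0 1 * B.val 1 0 -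
      (B.val 0 0 * A.val 1 1 + B.val 0 1 * A.val 1 0)) * X +
    C (A.val 0 1 * B.val 1 1 - B.val 0 1 * A.val 1 1) := by
    simp only [nm, dn, map_sub, map_add, map_mul]; ring
  rw [e] at h0
  have c0 := congrArg (fun p => coeff p 0) h0
  have c1 := congrArg (fun p => coeff p 1) h0
  have c2 := congrArg (fun p => coeff p 2) h0
  simp [coeff_X, coeff_C, -map_sub, -map_add, -map_mul, coeff_X_pow] at c0 c1 c2
  exact mk_eq_of_coeff A B (by linear_combination c2) (by linear_combination c1)
    (by linear_combination c0)

lemma sum_eq (f : F[X]) (u v : L) (hv : v ≠ 0) :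
    ∑ i ∈ Finset.range (f.natDegree + 1), algebraMap F L (f.coeff i) * u ^ i * v ^ (f.natDegree - i)
      = v ^ f.natDegree * aeval (u / v) f := by
  rw [aeval_eq_sum_range, Finset.mul_sum]
  refine Finset.sum_congr rfl fun i hi => ?_
  have hi' : i ≤ f.natDegree := by simpa [Nat.lt_succ_iff] using hi
  rw [Algebra.smul_def, div_pow, pow_sub₀ _ hv hi']
  field_simp

lemma sum_eq_zero' (f : F[X]) (u : L) :
    ∑ i ∈ Finset.range (f.natDegree + 1), algebraMap F L (f.coeff i) * u ^ i * 0 ^ (f.natDegree - i)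
      = algebraMap F L f.leadingCoeff * u ^ f.natDegree := by
  rw [Finset.sum_range_succ, Finset.sum_eq_zero]
  · simp
  · intro i hi
    have : f.natDegree - i ≠ 0 := by have := Finset.mem_range.1 hi; omega
    simp [this]

lemma aeval_rT (g h f : F[X]) (x : L) : aeval x (ratTransform g h f) =
    ∑ i ∈ Finset.range (f.natDegree + 1), algebraMap F L (f.coeff i) * (aeval x g) ^ i *
      (aeval x h) ^ (f.natDegree - i) := by
  simp [ratTransform]

lemma rT_root (g h f : F[X]) (hf : f.Monic) (hgh : IsCoprime g h) (x : L)
    (h0 : aeval x (ratTransform g h f) = 0) :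
    aeval x h ≠ 0 ∧ aeval (aeval x g / aeval x h) f = 0 := by
  rw [aeval_rT] at h0
  have hh : aeval x h ≠ 0 := by
    intro hh
    rw [hh, sum_eq_zero', hf.leadingCoeff, map_one, one_mul] at h0
    obtain ⟨u, v, huv⟩ := hgh
    have := congrArg (aeval x) huv
    rw [map_add, map_mul, map_mul, hh, eq_zero_of_pow_eq_zero h0] at this
    simp at this
  refine ⟨hh, ?_⟩
  rw [sum_eq _ _ _ hh] at h0
  exact (mul_eq_zero.1 h0).resolve_left (pow_ne_zero _ hh)

lemma rT_root' (g h f : F[X]) (x : L) (hh : aeval x h ≠ 0)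
    (h0 : aeval (aeval x g / aeval x h) f = 0) : aeval x (ratTransform g h f) = 0 := by
  rw [aeval_rT, sum_eq _ _ _ hh, h0, mul_zero]

lemma rT_mul (g h p q : F[X]) (hh : h ≠ 0) (hp : p ≠ 0) (hq : q ≠ 0) :
    ratTransform g h (p * q) = ratTransform g h p * ratTransform g h q := by
  apply IsFractionRing.injective F[X] (RatFunc F)
  have hh' : algebraMap F[X] (RatFunc F) h ≠ 0 := by simpa using hh
  have key : ∀ f : F[X], algebraMap F[X] (RatFunc F) (ratTransform g h f) =
      algebraMap F[X] (RatFunc F) h ^ f.natDegree *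
      aeval (algebraMap F[X] (RatFunc F) g / algebraMap F[X] (RatFunc F) h) f := by
    intro f
    rw [← sum_eq _ _ _ hh']
    simp [ratTransform]
  rw [map_mul, key, key, key, natDegree_mul hp hq, map_mul]
  ring

lemma rT_map (g h f : F[X]) : (ratTransform g h f).map (algebraMap F L) =
    ratTransform (g.map (algebraMap F L)) (h.map (algebraMap F L)) (f.map (algebraMap F L)) := by
  simp [ratTransform, Polynomial.map_sum]

lemma rT_monic (g h f : F[X]) (hf : f.Monic) (hg : g.Monic) (hd : h.natDegree < g.natDegree) :
    (ratTransform g h f).Monic ∧ (ratTransform g h f).natDegree = f.natDegree * g.natDegree := by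
  have hlt : (∑ i ∈ Finset.range f.natDegree, C (f.coeff i) * g ^ i * h ^ (f.natDegree - i)).degree
      < (g ^ f.natDegree).degree := by
    rw [degree_eq_natDegree (hg.pow _).ne_zero, hg.natDegree_pow]
    refine (degree_sum_le _ _).trans_lt ?_
    rw [Finset.sup_lt_iff (WithBot.bot_lt_coe _)]
    intro i hi
    have hi' := Finset.mem_range.1 hi
    refine lt_of_le_of_lt degree_le_natDegree ?_
    rw [Nat.cast_lt]
    calc (C (f.coeff i) * g ^ i * h ^ (f.natDegree - i)).natDegree
        ≤ i * g.natDegree + (f.natDegree - i) * h.natDegree := by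
          refine natDegree_mul_le.trans ?_
          have h1 := natDegree_C_mul_le (f.coeff i) (g ^ i)
          have h2 : (g ^ i).natDegree ≤ i * g.natDegree := natDegree_pow_le
          have h3 : (h ^ (f.natDegree - i)).natDegree ≤ (f.natDegree - i) * h.natDegree :=
            natDegree_pow_le
          omega
      _ < i * g.natDegree + (f.natDegree - i) * g.natDegree := by
          have : 0 < f.natDegree - i := by omega
          gcongr
      _ = f.natDegree * g.natDegree := by
          rw [← add_mul]; congr 1; omega
  have e : ratTransform g h f =
      ∑ i ∈ Finset.range f.natDegree, C (f.coeff i) * g ^ i * h ^ (f.natDegree - i)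
        + g ^ f.natDegree := by
    rw [ratTransform, Finset.sum_range_succ]; simp [hf]
  rw [e]
  refine ⟨Monic.add_of_right (hg.pow _) hlt, ?_⟩
  rw [natDegree_eq_of_degree_eq (degree_add_eq_right_of_degree_lt hlt), hg.natDegree_pow]

end basic

section key
set_option linter.unusedSectionVars false
variable {F : Type*} [Field F] [Fintype F]

lemma mobiusRatFunc_eq (A : GL (Fin 2) F) :
    mobiusRatFunc A = mob A (RatFunc.X : RatFunc F) := by
  rw [mob, aeval_nm, aeval_dn]; rfl

lemma aeval_ratX (p : F[X]) : aeval (RatFunc.X : RatFunc F) p = algebraMap F[X] (RatFunc F) p :=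
  RatFunc.aeval_X_left_eq_algebraMap p

noncomputable instance (G : Subgroup (PGL2 F)) : Fintype G := Fintype.ofFinite G

noncomputable def rep (G : Subgroup (PGL2 F)) (s : G) : GL (Fin 2) F := Quotient.out s.1

lemma rep_mk (G : Subgroup (PGL2 F)) (s : G) : PGL2.mk (rep G s) = s.1 :=
  QuotientGroup.out_eq' s.1

lemma dn_ne_zero (A : GL (Fin 2) F) : dn A ≠ 0 := by
  intro h
  have h0 := congrArg (fun p => coeff p 0) h
  have h1 := congrArg (fun p => coeff p 1) h
  simp [dn] at h0 h1
  exact det_ne A (by rw [h0, h1]; ring)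

lemma generic_prod (G : Subgroup (PGL2 F)) (g h : F[X]) (hQ : IsQuotientMap G g h) :
    g.map (algebraMap F (RatFunc F)) - C (algebraMap F[X] (RatFunc F) g / algebraMap F[X] (RatFunc F) h) *
      h.map (algebraMap F (RatFunc F)) = ∏ s : G, (X - C (mob (rep G s) (RatFunc.X : RatFunc F))) := by
  obtain ⟨hg, hgh, hh, hd, hN, hinv⟩ := hQ
  have hh' : algebraMap F[X] (RatFunc F) h ≠ 0 := by simpa using hh
  have hg' : algebraMap F[X] (RatFunc F) g ≠ 0 := by simpa using hg.ne_zero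
  have hdeg : (C (algebraMap F[X] (RatFunc F) g / algebraMap F[X] (RatFunc F) h) *
      h.map (algebraMap F (RatFunc F))).degree < (g.map (algebraMap F (RatFunc F))).degree := by
    rw [degree_C_mul (div_ne_zero hg' hh'), degree_map, degree_map]
    exact degree_lt_degree hd
  have hmon : (g.map (algebraMap F (RatFunc F)) - C (algebraMap F[X] (RatFunc F) g / algebraMap F[X] (RatFunc F) h) *
      h.map (algebraMap F (RatFunc F))).Monic := (hg.map _).sub_of_left hdeg
  apply eq_of_monic_of_dvd_of_natDegree_le (monic_prod_of_monic _ _ fun s _ => monic_X_sub_C _) hmon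
  · apply Fintype.prod_dvd_of_coprime
    · apply pairwise_coprime_X_sub_C
      intro s t hst
      apply Subtype.ext
      rw [← rep_mk G s, ← rep_mk G t]
      refine mob_inj _ _ _ ?_ ?_ ?_ hst
      · intro p _ hp
        rw [aeval_ratX] at hp
        simpa using hp
      · rw [aeval_ratX]; simpa using dn_ne_zero _
      · rw [aeval_ratX]; simpa using dn_ne_zero _
    · intro s
      rw [dvd_iff_isRoot, IsRoot.def]
      have := hinv (rep G s) (by rw [rep_mk]; exact s.2)
      rw [mobiusRatFunc_eq] at this
      have hne : aeval (mob (rep G s) (RatFunc.X : RatFunc F)) h ≠ 0 := by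
        intro h0
        rw [h0, div_zero] at this
        exact div_ne_zero hg' hh' this.symm
      rw [← this]
      simp only [eval_sub, eval_mul, eval_C, eval_map_algebraMap]
      rw [div_mul_cancel₀ _ hne, sub_self]
  · rw [natDegree_eq_of_degree_eq (degree_sub_eq_left_of_degree_lt hdeg), natDegree_map, hN,
      natDegree_prod_of_monic _ _ fun s _ => monic_X_sub_C _]
    simp [Nat.card_eq_fintype_card]

lemma cleared (G : Subgroup (PGL2 F)) (g h : F[X]) (hQ : IsQuotientMap G g h) :
    (C h * ∏ s : G, (C (dn (rep G s)) * X - C (nm (rep G s))) : F[X][X]) =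
      C (∏ s : G, dn (rep G s)) * (g.map C * C h - C g * h.map C) := by
  have hp := generic_prod G g h hQ
  have hh' : algebraMap F[X] (RatFunc F) h ≠ 0 := by simpa using hQ.2.2.1
  apply map_injective (algebraMap F[X] (RatFunc F)) (IsFractionRing.injective _ _)
  have hc : (algebraMap F[X] (RatFunc F)).comp C = algebraMap F (RatFunc F) := by
    ext x; simp
  have h1 : ∀ s : G, (C (algebraMap F[X] (RatFunc F) (dn (rep G s))) * X -
      C (algebraMap F[X] (RatFunc F) (nm (rep G s)))) =
      C (algebraMap F[X] (RatFunc F) (dn (rep G s))) *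
        (X - C (mob (rep G s) (RatFunc.X : RatFunc F))) := by
    intro s
    have : algebraMap F[X] (RatFunc F) (dn (rep G s)) ≠ 0 := by simpa using dn_ne_zero _
    rw [mul_sub, ← C_mul, mob, aeval_ratX, aeval_ratX, mul_div_cancel₀ _ this]
  simp only [Polynomial.map_mul, Polynomial.map_sub, map_C, Polynomial.map_prod, map_X,
    Polynomial.map_map, hc]
  rw [Finset.prod_congr rfl fun s _ => h1 s, Finset.prod_mul_distrib, ← hp, map_prod, map_prod]
  have h2 : C (algebraMap F[X] (RatFunc F) g) = C (algebraMap F[X] (RatFunc F) h) *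
    C (algebraMap F[X] (RatFunc F) g / algebraMap F[X] (RatFunc F) h) := by
    rw [← C_mul, mul_div_cancel₀ _ hh']
  rw [h2]
  ring

variable {L : Type*} [Field L] [Algebra F L]

lemma special (G : Subgroup (PGL2 F)) (g h : F[X]) (hQ : IsQuotientMap G g h) (x : L) :
    (C (aeval x h) * ∏ s : G, (C (aeval x (dn (rep G s))) * X - C (aeval x (nm (rep G s)))) : L[X]) =
      C (∏ s : G, aeval x (dn (rep G s))) * (g.map (algebraMap F L) * C (aeval x h) -
        C (aeval x g) * h.map (algebraMap F L)) := by
  have := congrArg (Polynomial.map (aeval x : F[X] →ₐ[F] L).toRingHom) (cleared G g h hQ)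
  have hc : (aeval x : F[X] →ₐ[F] L).toRingHom.comp C = algebraMap F L := by
    ext x; simp
  simp only [Polynomial.map_mul, Polynomial.map_sub, map_C, Polynomial.map_prod, map_X,
    Polynomial.map_map, hc] at this
  simpa using this

lemma h_ne_iff (G : Subgroup (PGL2 F)) (g h : F[X]) (hQ : IsQuotientMap G g h) (x : L) :
    aeval x h ≠ 0 ↔ ∀ A : GL (Fin 2) F, PGL2.mk A ∈ G → aeval x (dn A) ≠ 0 := by
  have hs := special G g h hQ x
  constructor
  · intro hx A hA h0
    have hz : aeval x (dn (rep G ⟨_, hA⟩)) = 0 := by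
      by_contra hne
      exact dn_congr _ A (rep_mk G ⟨_, hA⟩) x hne h0
    rw [Finset.prod_eq_zero (f := fun s : G => aeval x (dn (rep G s)))
      (Finset.mem_univ (⟨_, hA⟩ : G)) hz, C_0, zero_mul] at hs
    refine (mul_ne_zero (C_ne_zero.2 hx) (Finset.prod_ne_zero_iff.2 fun s _ h0 => ?_)) hs
    have e0 := congrArg (fun p => coeff p 0) h0
    have e1 := congrArg (fun p => coeff p 1) h0
    simp at e0 e1
    exact nm_ne_of_dn _ _ e1 e0
  · intro hA hx
    rw [hx, C_0, zero_mul, mul_zero, zero_sub] at hs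
    have hgx : aeval x g ≠ 0 := by
      intro hg0
      obtain ⟨u, v, huv⟩ := hQ.2.1
      have := congrArg (aeval x) huv
      rw [map_add, map_mul, map_mul, hx, hg0] at this
      simp at this
    refine mul_ne_zero (C_ne_zero.2 (Finset.prod_ne_zero_iff.2 fun s _ => hA _ ?_))
      (neg_ne_zero.2 (mul_ne_zero (C_ne_zero.2 hgx) ?_)) hs.symm
    · rw [rep_mk]; exact s.2
    · exact (Polynomial.map_ne_zero_iff (algebraMap F L).injective).2 hQ.2.2.1

lemma fiber_prod (G : Subgroup (PGL2 F)) (g h : F[X]) (hQ : IsQuotientMap G g h) (x : L)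
    (hx : aeval x h ≠ 0) :
    g.map (algebraMap F L) - C (aeval x g / aeval x h) * h.map (algebraMap F L) =
      ∏ s : G, (X - C (mob (rep G s) x)) := by
  have hs := special G g h hQ x
  have hA := (h_ne_iff G g h hQ x).1 hx
  have hA' : ∀ s : G, aeval x (dn (rep G s)) ≠ 0 := fun s => hA _ (by rw [rep_mk]; exact s.2)
  have h1 : ∀ s : G, (C (aeval x (dn (rep G s))) * X - C (aeval x (nm (rep G s)))) =
      C (aeval x (dn (rep G s))) * (X - C (mob (rep G s) x)) := by
    intro s
    rw [mul_sub, ← C_mul, mob, mul_div_cancel₀ _ (hA' s)]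
  have h2 : C (aeval x g) = C (aeval x h) * C (aeval x g / aeval x h) := by
    rw [← C_mul, mul_div_cancel₀ _ hx]
  rw [Finset.prod_congr rfl fun s _ => h1 s, Finset.prod_mul_distrib, h2, map_prod] at hs
  have hD : ∏ s : G, (C (aeval x (dn (rep G s))) : L[X]) ≠ 0 :=
    Finset.prod_ne_zero_iff.2 fun s _ => C_ne_zero.2 (hA' s)
  apply mul_left_cancel₀ (mul_ne_zero (C_ne_zero.2 hx) hD)
  linear_combination -hs

/-- the fiber of `Q` through `x` is the `G`-orbit of `x` -/
lemma fiber_iff (G : Subgroup (PGL2 F)) (g h : F[X]) (hQ : IsQuotientMap G g h) (x y : L)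
    (hx : aeval x h ≠ 0) :
    (∃ A : GL (Fin 2) F, PGL2.mk A ∈ G ∧ y = mob A x) ↔
      (aeval y h ≠ 0 ∧ aeval y g / aeval y h = aeval x g / aeval x h) := by
  have hp := congrArg (eval y) (fiber_prod G g h hQ x hx)
  simp only [eval_sub, eval_mul, eval_C, eval_map_algebraMap, eval_prod, eval_X] at hp
  constructor
  · rintro ⟨A, hA, rfl⟩
    have hr : mob A x = mob (rep G ⟨_, hA⟩) x := mob_congr _ _ (rep_mk G ⟨_, hA⟩).symm x
    rw [Finset.prod_eq_zero (Finset.mem_univ (⟨_, hA⟩ : G)) (by rw [hr, sub_self]), sub_eq_zero] at hp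
    have hne : aeval (mob A x) h ≠ 0 := by
      intro h0
      obtain ⟨u, v, huv⟩ := hQ.2.1
      have := congrArg (aeval (mob A x)) huv
      rw [map_add, map_mul, map_mul, hp, h0] at this
      simp at this
    exact ⟨hne, by rw [hp, mul_div_cancel_right₀ _ hne]⟩
  · rintro ⟨hy, he⟩
    rw [← he, div_mul_cancel₀ _ hy, sub_self] at hp
    obtain ⟨s, -, hs⟩ := Finset.prod_eq_zero_iff.1 hp.symm
    exact ⟨rep G s, by rw [rep_mk]; exact s.2, sub_eq_zero.1 hs⟩

end key

section orb
set_option linter.unusedSectionVars false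
variable {F : Type*} [Field F] [Fintype F]

lemma deg_dvd {x : AlgebraicClosure F} (p q : F[X]) :
    (minpoly F (aeval x p / aeval x q)).natDegree ∣ (minpoly F x).natDegree := by
  have hx : IsIntegral F x := Algebra.IsIntegral.isIntegral x
  have hy : IsIntegral F (aeval x p / aeval x q) := Algebra.IsIntegral.isIntegral _
  rw [← IntermediateField.adjoin.finrank hx, ← IntermediateField.adjoin.finrank hy]
  apply IntermediateField.finrank_dvd_of_le_right
  rw [IntermediateField.adjoin_simple_le_iff]
  have : ∀ p : F[X], aeval x p ∈ IntermediateField.adjoin F {x} := fun p =>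
    IntermediateField.algebra_adjoin_le_adjoin _ _ (aeval_mem_adjoin_singleton F x)
  exact div_mem (this p) (this q)

lemma deg_mob (A : GL (Fin 2) F) (x : AlgebraicClosure F) (h : aeval x (dn A) ≠ 0) :
    (minpoly F (mob A x)).natDegree = (minpoly F x).natDegree := by
  apply Nat.dvd_antisymm (deg_dvd _ _)
  have := deg_dvd (x := mob A x) (nm A⁻¹) (dn A⁻¹)
  rwa [← mob, (mob_inv A x h).2] at this

lemma NR_dn (G : Subgroup (PGL2 F)) (r : F[X]) (hr : memNR G r) (x : AlgebraicClosure F)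
    (hx : aeval x r = 0) (A : GL (Fin 2) F) (hA : PGL2.mk A ∈ G) : aeval x (dn A) ≠ 0 := by
  obtain ⟨z, hz, h00, h01, h10, h11⟩ := inv_entries A
  intro h0
  rw [aeval_dn] at h0
  have hd := det_ne A
  have hc : A.val 1 0 ≠ 0 := by
    intro hc
    rw [hc] at h0
    have : A.val 1 1 = 0 := by simpa using h0
    rw [hc, this] at hd
    simp at hd
  have hc' : algebraMap F (AlgebraicClosure F) (A.val 1 0) ≠ 0 := (_root_.map_ne_zero _).2 hc
  have hne := hr.2 A⁻¹ (G.inv_mem hA) (by rw [h10]; exact neg_ne_zero.2 (mul_ne_zero hz hc))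
  apply hne
  have he : x = algebraMap F (AlgebraicClosure F) ((A⁻¹).val 0 0 / (A⁻¹).val 1 0) := by
    rw [h00, h10, mul_comm z, mul_comm z, ← neg_mul, mul_div_mul_right _ _ hz, map_div₀, map_neg,
      eq_div_iff (neg_ne_zero.2 hc')]
    linear_combination -h0
  rw [he, aeval_algebraMap_apply] at hx
  simpa using hx

lemma subst_coeff (A : GL (Fin 2) F) (r : F[X]) : (mobiusSubst A r).coeff r.natDegree =
    ∑ i ∈ Finset.range (r.natDegree + 1), algebraMap F F (r.coeff i) * (A.val 0 0) ^ i *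
      (A.val 1 0) ^ (r.natDegree - i) := by
  rw [mobiusSubst, finsetSum_coeff]
  refine Finset.sum_congr rfl fun i hi => ?_
  have hi' : i + (r.natDegree - i) = r.natDegree := by have := Finset.mem_range.1 hi; omega
  have h1 : (C (A.val 0 0) * X + C (A.val 0 1)).natDegree ≤ 1 := by compute_degree
  have h2 : (C (A.val 1 0) * X + C (A.val 1 1)).natDegree ≤ 1 := by compute_degree
  have h1' := natDegree_pow_le_of_le i h1
  have h2' := natDegree_pow_le_of_le (r.natDegree - i) h2
  have e1 := coeff_pow_of_natDegree_le (m := i) h1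
  have e2 := coeff_pow_of_natDegree_le (m := r.natDegree - i) h2
  rw [mul_one] at h1' h2' 
  have e := coeff_mul_add_eq_of_natDegree_le h1' h2'
  rw [hi'] at e
  rw [mul_assoc, coeff_C_mul, e]
  simp at e1 e2
  rw [e1, e2]
  simp [mul_assoc]

lemma subst_ne (G : Subgroup (PGL2 F)) (r : F[X]) (hr : memNR G r)
    (A : GL (Fin 2) F) (hA : PGL2.mk A ∈ G) : mobiusSubst A r ≠ 0 := by
  intro h0
  have := subst_coeff A r
  rw [h0, coeff_zero] at this
  by_cases hc : A.val 1 0 = 0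
  · rw [hc, sum_eq_zero', hr.1.leadingCoeff] at this
    rw [map_one, one_mul] at this
    have h1 := eq_zero_of_pow_eq_zero this.symm
    apply det_ne A
    rw [h1, hc]; ring
  · rw [sum_eq _ _ _ hc] at this
    refine hr.2 A hA hc ?_
    have := (mul_eq_zero.1 this.symm).resolve_left (pow_ne_zero _ hc)
    simpa using this

lemma subst_deg (A : GL (Fin 2) F) (r : F[X]) : (mobiusSubst A r).natDegree ≤ r.natDegree := by
  apply natDegree_sum_le_of_forall_le
  intro i hi
  have hi' : i + (r.natDegree - i) = r.natDegree := by have := Finset.mem_range.1 hi; omega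
  have h1 : (C (A.val 0 0) * X + C (A.val 0 1)).natDegree ≤ 1 := by compute_degree
  have h2 : (C (A.val 1 0) * X + C (A.val 1 1)).natDegree ≤ 1 := by compute_degree
  have h1' := natDegree_pow_le_of_le i h1
  have h2' := natDegree_pow_le_of_le (r.natDegree - i) h2
  rw [mul_assoc]
  refine (natDegree_C_mul_le _ _).trans (natDegree_mul_le.trans ?_)
  omega

lemma star_eq (G : Subgroup (PGL2 F)) (r : F[X]) (hr : memNR G r) (hi : Irreducible r)
    (x : AlgebraicClosure F) (hx : aeval x r = 0) (A : GL (Fin 2) F) (hA : PGL2.mk A ∈ G) :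
    mobiusStar A r = minpoly F (mob A⁻¹ x) := by
  have hdx := NR_dn G r hr x hx A⁻¹ (G.inv_mem hA)
  have hmr : minpoly F x = r := (minpoly.eq_of_irreducible_of_monic hi hx hr.1).symm
  obtain ⟨h1, h2⟩ := mob_inv A⁻¹ x hdx
  have hdeg := deg_mob A⁻¹ x hdx
  set y := mob A⁻¹ x with hy
  rw [inv_inv] at h1 h2
  have h0 : aeval y (mobiusSubst A r) = 0 :=
    rT_root' (nm A) (dn A) r y h1 (by rw [← mob, h2]; exact hx)
  have hne := subst_ne G r hr A hA
  have hlc : ((mobiusSubst A r).leadingCoeff)⁻¹ ≠ 0 := inv_ne_zero (leadingCoeff_ne_zero.2 hne)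
  have hmon : (mobiusStar A r).Monic := by
    rw [mobiusStar, mul_comm]; exact monic_mul_leadingCoeff_inv hne
  apply eq_of_monic_of_dvd_of_natDegree_le
    (minpoly.monic (Algebra.IsIntegral.isIntegral y)) hmon
  · exact (minpoly.dvd F y h0).mul_left _
  · rw [hdeg, hmr, mobiusStar]
    exact (natDegree_C_mul_le _ _).trans (subst_deg A r)

/-- monic irreducible factors -/
def fac (P : F[X]) : Set F[X] := {r | r.Monic ∧ Irreducible r ∧ r ∣ P}

lemma fac_root {P r : F[X]} (hr : r ∈ fac P) : ∃ x : AlgebraicClosure F, aeval x r = 0 ∧ aeval x P = 0 := by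
  obtain ⟨x, hx⟩ := IsAlgClosed.exists_aeval_eq_zero (AlgebraicClosure F) r
    (degree_pos_of_irreducible hr.2.1).ne'
  refine ⟨x, hx, ?_⟩
  obtain ⟨c, rfl⟩ := hr.2.2
  rw [map_mul, hx, zero_mul]

lemma fac_NR (G : Subgroup (PGL2 F)) (g h : F[X]) (hQ : IsQuotientMap G g h) (f r : F[X])
    (hf : f.Monic) (hr : r ∈ fac (ratTransform g h f)) : memNR G r := by
  refine ⟨hr.1, fun A hA hc h0 => ?_⟩
  have h1 : aeval (A.val 0 0 / A.val 1 0) (ratTransform g h f) = 0 := by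
    obtain ⟨c, hc⟩ := hr.2.2
    rw [hc, map_mul]
    simp [h0]
  have h2 := (h_ne_iff G g h hQ _).1 (rT_root g h f hf hQ.2.1 _ h1).1 A⁻¹ (G.inv_mem hA)
  apply h2
  obtain ⟨z, hz, h00, h01, h10, h11⟩ := inv_entries A
  rw [aeval_dn, h10, h11]
  simp
  field_simp
  ring

lemma fac_orbit (G : Subgroup (PGL2 F)) (g h : F[X]) (hQ : IsQuotientMap G g h) (f r : F[X])
    (hf : f.Monic) (hfi : Irreducible f) (hr : r ∈ fac (ratTransform g h f)) :
    fac (ratTransform g h f) = polyOrbit G r := by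
  have hNR := fac_NR G g h hQ f r hf hr
  obtain ⟨x, hx, hxP⟩ := fac_root hr
  obtain ⟨hxh, hxf⟩ := rT_root g h f hf hQ.2.1 x hxP
  have hmf : ∀ y : AlgebraicClosure F, aeval y f = 0 → minpoly F y = f := fun y hy =>
    (minpoly.eq_of_irreducible_of_monic hfi hy hf).symm
  ext t
  constructor
  · intro ht
    obtain ⟨y, hy, hyP⟩ := fac_root ht
    obtain ⟨hyh, hyf⟩ := rT_root g h f hf hQ.2.1 y hyP
    have hc : IsConjRoot F (aeval x g / aeval x h) (aeval y g / aeval y h) := by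
      rw [isConjRoot_def, hmf _ hxf, hmf _ hyf]
    obtain ⟨σ, hσ⟩ := isConjRoot_iff_exists_algEquiv.1 hc
    have hs : ∀ p : F[X], aeval (σ y) p = σ (aeval y p) := fun p => by
      exact aeval_algHom_apply σ y p
    have hsh : aeval (σ y) h ≠ 0 := by rw [hs]; simpa using hyh
    obtain ⟨A, hA, hAy⟩ := (fiber_iff G g h hQ x (σ y) hxh).2
      ⟨hsh, by rw [hs, hs, ← hσ, map_div₀]⟩
    refine ⟨A⁻¹, G.inv_mem hA, ?_⟩
    rw [star_eq G r hNR hr.2.1 x hx A⁻¹ (G.inv_mem hA), inv_inv, ← hAy]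
    exact minpoly.eq_of_irreducible_of_monic ht.2.1 (by rw [hs, hy, map_zero]) ht.1
  · rintro ⟨A, hA, rfl⟩
    rw [star_eq G r hNR hr.2.1 x hx A hA]
    have hint : IsIntegral F (mob A⁻¹ x) := Algebra.IsIntegral.isIntegral _
    refine ⟨minpoly.monic hint, minpoly.irreducible hint, minpoly.dvd F _ ?_⟩
    obtain ⟨h1, h2⟩ := (fiber_iff G g h hQ x (mob A⁻¹ x) hxh).1 ⟨A⁻¹, G.inv_mem hA, rfl⟩
    exact rT_root' g h f _ h1 (by rw [h2]; exact hxf)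

lemma fac_inj (g h : F[X]) (hgh : IsCoprime g h) (f f' r : F[X])
    (hf : f.Monic) (hfi : Irreducible f) (hf' : f'.Monic) (hfi' : Irreducible f')
    (hr : r ∈ fac (ratTransform g h f)) (hr' : r ∈ fac (ratTransform g h f')) : f = f' := by
  obtain ⟨x, hx, hxP⟩ := fac_root hr
  have hxP' : aeval x (ratTransform g h f') = 0 := by
    obtain ⟨c, hc⟩ := hr'.2.2
    rw [hc, map_mul, hx, zero_mul]
  rw [minpoly.eq_of_irreducible_of_monic hfi (rT_root g h f hf hgh x hxP).2 hf,
    minpoly.eq_of_irreducible_of_monic hfi' (rT_root g h f' hf' hgh x hxP').2 hf']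

lemma exists_f (G : Subgroup (PGL2 F)) (g h : F[X]) (hQ : IsQuotientMap G g h) (r : F[X])
    (hr : memNR G r) (hi : Irreducible r) :
    ∃ f : F[X], f.Monic ∧ Irreducible f ∧ r ∈ fac (ratTransform g h f) := by
  obtain ⟨x, hx⟩ := IsAlgClosed.exists_aeval_eq_zero (AlgebraicClosure F) r
    (degree_pos_of_irreducible hi).ne'
  have hxh := (h_ne_iff G g h hQ x).2 (NR_dn G r hr x hx)
  have hint : IsIntegral F (aeval x g / aeval x h) := Algebra.IsIntegral.isIntegral _
  refine ⟨_, minpoly.monic hint, minpoly.irreducible hint, hr.1, hi, ?_⟩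
  rw [minpoly.eq_of_irreducible_of_monic hi hx hr.1]
  exact minpoly.dvd F x (rT_root' g h _ x hxh (minpoly.aeval F _))

lemma fac_deg_dvd (g h : F[X]) (hgh : IsCoprime g h) (f r : F[X])
    (hf : f.Monic) (hfi : Irreducible f)
    (hr : r ∈ fac (ratTransform g h f)) : f.natDegree ∣ r.natDegree := by
  obtain ⟨x, hx, hxP⟩ := fac_root hr
  rw [minpoly.eq_of_irreducible_of_monic hfi (rT_root g h f hf hgh x hxP).2 hf,
    minpoly.eq_of_irreducible_of_monic hr.2.1 hx hr.1]
  exact deg_dvd g h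

lemma fac_finite (P : F[X]) (hP : P ≠ 0) : (fac P).Finite := by
  classical
  refine (UniqueFactorizationMonoid.normalizedFactors P).toFinset.finite_toSet.subset ?_
  intro r hr
  rw [Finset.mem_coe, Multiset.mem_toFinset, UniqueFactorizationMonoid.mem_normalizedFactors_iff' hP]
  exact ⟨hr.2.1, hr.1.normalize_eq_self, hr.2.2⟩

lemma fac_nonempty (P : F[X]) (hP : ¬ IsUnit P) : (fac P).Nonempty := by
  obtain ⟨q, hq⟩ := exists_monic_irreducible_factor P hP
  exact ⟨q, hq⟩

lemma fac_deg_le (P : F[X]) (hP : P ≠ 0) (d : ℕ) (hd : ∀ r ∈ fac P, r.natDegree = d) :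
    (fac P).ncard * d ≤ P.natDegree ∧ (Squarefree P → (fac P).ncard * d = P.natDegree) := by
  classical
  set s := (fac_finite P hP).toFinset with hs
  have hmem : ∀ r, r ∈ s ↔ r ∈ fac P := fun r => by simp [hs]
  have hcard : (fac P).ncard = s.card := Set.ncard_eq_toFinset_card _ _
  have hdeg : (∏ r ∈ s, r).natDegree = s.card * d := by
    rw [natDegree_prod_of_monic _ _ fun r hr => ((hmem r).1 hr).1,
      Finset.sum_congr rfl fun r hr => hd r ((hmem r).1 hr)]
    simp
  have hdvd : ∏ r ∈ s, r ∣ P := by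
    apply Finset.prod_dvd_of_coprime
    · intro a ha b hb hab
      have ha' := (hmem a).1 ha
      have hb' := (hmem b).1 hb
      refine (ha'.2.1.coprime_iff_not_dvd).2 fun h => hab ?_
      exact eq_of_monic_of_associated ha'.1 hb'.1 (ha'.2.1.associated_of_dvd hb'.2.1 h)
    · exact fun r hr => ((hmem r).1 hr).2.2
  rw [hcard, ← hdeg]
  refine ⟨natDegree_le_of_dvd hdvd hP, fun hsq => ?_⟩
  obtain ⟨u, hu⟩ := hdvd
  have hunit : IsUnit u := by
    by_contra hn
    obtain ⟨q, hq⟩ := fac_nonempty u hn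
    have hqP : q ∈ s := (hmem q).2 ⟨hq.1, hq.2.1, hu ▸ hq.2.2.mul_left _⟩
    refine hq.2.1.not_isUnit (hsq q ?_)
    rw [hu]
    exact mul_dvd_mul (Finset.dvd_prod_of_mem (fun r => r) hqP) hq.2.2
  conv_rhs => rw [hu]
  have hp0 : ∏ r ∈ s, r ≠ 0 := fun h0 => hP (by rw [hu, h0, zero_mul])
  rw [natDegree_mul hp0 hunit.ne_zero, natDegree_eq_zero_of_isUnit hunit, add_zero]

lemma bound (G : Subgroup (PGL2 F)) (g h : F[X]) (hQ : IsQuotientMap G g h) (f : F[X])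
    (hf : f.Monic) (hfi : Irreducible f) (hsq : ¬ Squarefree (ratTransform g h f)) :
    f.natDegree ≤ 2 := by
  by_contra hlt
  push Not at hlt
  obtain ⟨hmon, -⟩ := rT_monic g h f hf hQ.1 hQ.2.2.2.1
  simp only [Squarefree, not_forall] at hsq
  obtain ⟨w, hw, hwu⟩ := hsq
  obtain ⟨q, hq⟩ := fac_nonempty w hwu
  obtain ⟨x, hx, -⟩ := fac_root hq
  have hqq : q * q ∣ ratTransform g h f := (mul_dvd_mul hq.2.2 hq.2.2).trans hw
  have hqf : q ∈ fac (ratTransform g h f) := ⟨hq.1, hq.2.1, (dvd_mul_right q q).trans hqq⟩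
  have hxP : aeval x (ratTransform g h f) = 0 := by
    obtain ⟨c, hc⟩ := hqf.2.2
    rw [hc, map_mul, hx, zero_mul]
  obtain ⟨hxh, hxf⟩ := rT_root g h f hf hQ.2.1 x hxP
  have hdq : 2 < q.natDegree := lt_of_lt_of_le hlt
    (Nat.le_of_dvd hq.2.1.natDegree_pos (fac_deg_dvd g h hQ.2.1 f q hf hfi hqf))
  have hdeg2 : ∀ p : F[X], p.natDegree ≤ 2 → aeval x p = 0 → p = 0 := by
    intro p hp hp0
    by_contra hne
    have h1 := natDegree_le_of_dvd (minpoly.dvd F x hp0) hne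
    rw [← minpoly.eq_of_irreducible_of_monic hq.2.1 hx hq.1] at h1
    omega
  set β := aeval x g / aeval x h with hβ
  let ι := algebraMap F (AlgebraicClosure F)
  have hsepf : (f.map ι).Separable := (PerfectField.separable_of_irreducible hfi).map
  obtain ⟨f1, hf1⟩ : X - C β ∣ f.map ι := by
    rw [dvd_iff_isRoot, IsRoot.def, eval_map_algebraMap]; exact hxf
  have hfne : f.map ι ≠ 0 := (hf.map ι).ne_zero
  have hf1ne : f1 ≠ 0 := fun h0 => hfne (by rw [hf1, h0, mul_zero])
  have hf1β : eval β f1 ≠ 0 := by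
    intro h0
    obtain ⟨f2, hf2⟩ := dvd_iff_isRoot.2 h0
    have := hsepf.squarefree (X - C β) ⟨f2, by rw [hf1, hf2, mul_assoc]⟩
    exact not_isUnit_X_sub_C β this
  have hhK : h.map ι ≠ 0 := (Polynomial.map_ne_zero_iff ι.injective).2 hQ.2.2.1
  have e1 : (ratTransform g h f).map ι = (g.map ι - C β * h.map ι) *
      ratTransform (g.map ι) (h.map ι) f1 := by
    rw [rT_map, hf1, rT_mul _ _ _ _ hhK (X_sub_C_ne_zero β) hf1ne]
    congr 1
    simp [ratTransform, Finset.sum_range_succ]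
    ring
  have hdvd : (X - C x) * (X - C x) ∣ (ratTransform g h f).map ι := by
    have : X - C x ∣ q.map ι := by
      rw [dvd_iff_isRoot, IsRoot.def, eval_map_algebraMap]; exact hx
    refine (mul_dvd_mul this this).trans ?_
    rw [← Polynomial.map_mul]
    exact Polynomial.map_dvd ι hqq
  have hnd : ¬ (X - C x) ∣ ratTransform (g.map ι) (h.map ι) f1 := by
    rw [dvd_iff_isRoot, IsRoot.def, ← coe_aeval_eq_eval, aeval_rT, sum_eq]
    · refine mul_ne_zero (pow_ne_zero _ ?_) ?_
      · rw [coe_aeval_eq_eval, eval_map_algebraMap]; exact hxh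
      · simp only [coe_aeval_eq_eval, ι, eval_map_algebraMap]; exact hf1β
    · rw [coe_aeval_eq_eval, eval_map_algebraMap]; exact hxh
  rw [e1] at hdvd
  have hcop : IsCoprime ((X - C x) * (X - C x)) (ratTransform (g.map ι) (h.map ι) f1) := by
    have := (irreducible_X_sub_C x).coprime_iff_not_dvd.2 hnd
    exact this.mul_left this
  have hd2 := hcop.dvd_of_dvd_mul_right hdvd
  rw [fiber_prod G g h hQ x hxh] at hd2
  have hsep : (∏ s : G, (X - C (mob (rep G s) x))).Separable := by
    rw [separable_prod_X_sub_C_iff]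
    intro s t hst
    have hA := (h_ne_iff G g h hQ x).1 hxh
    apply Subtype.ext
    rw [← rep_mk G s, ← rep_mk G t]
    exact mob_inj _ _ _ hdeg2 (hA _ (by rw [rep_mk]; exact s.2)) (hA _ (by rw [rep_mk]; exact t.2)) hst
  exact not_isUnit_X_sub_C x (hsep.squarefree _ hd2)

lemma sqf (G : Subgroup (PGL2 F)) (g h : F[X]) (hQ : IsQuotientMap G g h) (f : F[X])
    (hf : f.Monic) (hfi : Irreducible f) (hd : dval g h < f.natDegree) :
    Squarefree (ratTransform g h f) := by
  by_contra hn
  refine absurd (le_csSup (s := {n : ℕ | ∃ f : F[X], f.Monic ∧ Irreducible f ∧ f.natDegree = n ∧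
    ¬ Squarefree (ratTransform g h f)}) ⟨2, ?_⟩ ⟨f, hf, hfi, rfl, hn⟩) (not_le.2 hd)
  rintro n ⟨f', hf', hfi', rfl, hn'⟩
  exact bound G g h hQ f' hf' hfi' hn'

lemma orbit_deg (G : Subgroup (PGL2 F)) (r t : F[X]) (hr : memNR G r) (hi : Irreducible r)
    (ht : t ∈ polyOrbit G r) : t.natDegree = r.natDegree := by
  obtain ⟨A, hA, rfl⟩ := ht
  obtain ⟨x, hx⟩ := IsAlgClosed.exists_aeval_eq_zero (AlgebraicClosure F) r
    (degree_pos_of_irreducible hi).ne'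
  rw [star_eq G r hr hi x hx A hA, deg_mob _ _ (NR_dn G r hr x hx A⁻¹ (G.inv_mem hA)),
    ← minpoly.eq_of_irreducible_of_monic hi hx hr.1]

lemma fin_deg (m : ℕ) : {f : F[X] | f.Monic ∧ Irreducible f ∧ f.natDegree = m}.Finite := by
  have : Finite (degreeLT F (m + 1)) := Finite.of_equiv _ (degreeLTEquiv F (m + 1)).symm.toEquiv
  refine (Set.toFinite (degreeLT F (m + 1) : Set F[X])).subset ?_
  rintro f ⟨hf, -, hd⟩
  rw [SetLike.mem_coe, mem_degreeLT]
  refine degree_le_natDegree.trans_lt ?_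
  rw [hd]; exact_mod_cast Nat.lt_succ_self m

end orb

end CI

theorem count_irreducible_eq_sum_omega (F : Type*) [Field F] [Fintype F]
    (G : Subgroup (PGL2 F)) (g h : F[X]) (hQ : IsQuotientMap G g h)
    (m : ℕ) (hm : dval g h < m) :
    {f : F[X] | f.Monic ∧ Irreducible f ∧ f.natDegree = m}.ncard
      = ∑ k ∈ (Nat.card G).divisors, omegaG G (m * (Nat.card G / k)) k := by
  classical
  have hN : g.natDegree = Nat.card G := hQ.2.2.2.2.1
  have hNpos : 0 < Nat.card G := Nat.card_pos
  have hP : ∀ f : F[X], f.Monic → ratTransform g h f ≠ 0 := fun f hf =>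
    (CI.rT_monic g h f hf hQ.1 hQ.2.2.2.1).1.ne_zero
  have hPd : ∀ f : F[X], f.Monic → (ratTransform g h f).natDegree = f.natDegree * Nat.card G :=
    fun f hf => hN ▸ (CI.rT_monic g h f hf hQ.1 hQ.2.2.2.1).2
  -- numerics for a factor
  have hall : ∀ f : F[X], f.Monic → Irreducible f → ∀ r ∈ CI.fac (ratTransform g h f),
      ((CI.fac (ratTransform g h f)).ncard * r.natDegree ≤ f.natDegree * Nat.card G) ∧
      (dval g h < f.natDegree →
        (CI.fac (ratTransform g h f)).ncard * r.natDegree = f.natDegree * Nat.card G) := by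
    intro f hf hfi r hr
    have hd : ∀ t ∈ CI.fac (ratTransform g h f), t.natDegree = r.natDegree := by
      intro t ht
      rw [CI.fac_orbit G g h hQ f r hf hfi hr] at ht
      exact CI.orbit_deg G r t (CI.fac_NR G g h hQ f r hf hr) hr.2.1 ht
    have := CI.fac_deg_le _ (hP f hf) _ hd
    rw [hPd f hf] at this
    exact ⟨this.1, fun hlt => this.2 (CI.sqf G g h hQ f hf hfi hlt)⟩
  have hne : ∀ f : F[X], f.Monic → Irreducible f → (CI.fac (ratTransform g h f)).Nonempty := by
    intro f hf hfi
    apply CI.fac_nonempty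
    intro hu
    have := natDegree_eq_zero_of_isUnit hu
    rw [hPd f hf] at this
    have h2 := hfi.natDegree_pos
    exact (Nat.mul_pos h2 hNpos).ne' this
  have hkk : ∀ f : F[X], f.Monic → Irreducible f → f.natDegree = m →
      ∀ r ∈ CI.fac (ratTransform g h f),
      (CI.fac (ratTransform g h f)).ncard ∣ Nat.card G ∧
      r.natDegree = m * (Nat.card G / (CI.fac (ratTransform g h f)).ncard) := by
    intro f hf hfi hfm r hr
    have h1 := (hall f hf hfi r hr).2 (by omega)
    obtain ⟨s, hs⟩ := CI.fac_deg_dvd g h hQ.2.1 f r hf hfi hr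
    have hk : 0 < (CI.fac (ratTransform g h f)).ncard :=
      (Set.ncard_pos (CI.fac_finite _ (hP f hf))).2 ⟨r, hr⟩
    rw [hfm] at hs h1
    have hG : (CI.fac (ratTransform g h f)).ncard * s = Nat.card G := by
      apply Nat.eq_of_mul_eq_mul_left (by omega : 0 < m)
      rw [← h1, hs]; ring
    refine ⟨⟨s, hG.symm⟩, ?_⟩
    rw [hs, ← hG, Nat.mul_div_cancel_left _ hk]
  have hfin := CI.fin_deg (F := F) m
  rw [Set.ncard_eq_toFinset_card _ hfin]
  rw [Finset.card_eq_sum_card_fiberwise (f := fun f => (CI.fac (ratTransform g h f)).ncard)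
    (t := (Nat.card G).divisors)]
  · refine Finset.sum_congr rfl fun k hk => ?_
    rw [omegaG, ← Set.ncard_coe_finset]
    have hinj : Set.InjOn (fun f : F[X] => CI.fac (ratTransform g h f))
        ↑({f ∈ hfin.toFinset | (CI.fac (ratTransform g h f)).ncard = k} : Finset F[X]) := by
      intro f hf f' hf' he
      simp at hf hf'
      obtain ⟨r, hr⟩ := hne f hf.1.1 hf.1.2.1
      exact CI.fac_inj g h hQ.2.1 f f' r hf.1.1 hf.1.2.1 hf'.1.1 hf'.1.2.1 hr
        (by simpa only [← he] using hr)
    rw [← Set.ncard_image_of_injOn hinj]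
    congr 1
    ext O
    constructor
    · rintro ⟨f, hf, rfl⟩
      simp at hf
      obtain ⟨⟨hf1, hf2, hf3⟩, hf4⟩ := hf
      obtain ⟨r, hr⟩ := hne f hf1 hf2
      refine ⟨r, CI.fac_NR G g h hQ f r hf1 hr, hr.2.1, ?_, CI.fac_orbit G g h hQ f r hf1 hf2 hr, hf4⟩
      rw [(hkk f hf1 hf2 hf3 r hr).2, hf4]
    · rintro ⟨r, hr1, hr2, hr3, rfl, hr5⟩
      obtain ⟨f, hf, hfi, hrf⟩ := CI.exists_f G g h hQ r hr1 hr2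
      have ho := CI.fac_orbit G g h hQ f r hf hfi hrf
      obtain ⟨h1, h2⟩ := hall f hf hfi r hrf
      rw [ho, hr5, hr3] at h1 h2
      have e : k * (m * (Nat.card G / k)) = m * Nat.card G := by
        rw [mul_left_comm, Nat.mul_div_cancel' (Nat.dvd_of_mem_divisors hk)]
      rw [e] at h1 h2
      have h3 : m ≤ f.natDegree := Nat.le_of_mul_le_mul_right h1 hNpos
      have h4 := Nat.eq_of_mul_eq_mul_right hNpos (h2 (by omega))
      refine ⟨f, ?_, ho⟩
      simp
      exact ⟨⟨hf, hfi, h4.symm⟩, by rw [ho, hr5]⟩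
  · intro f hf
    simp at hf
    obtain ⟨r, hr⟩ := hne f hf.1 hf.2.1
    simp only [Finset.mem_coe, Nat.mem_divisors]
    exact ⟨(hkk f hf.1 hf.2.1 hf.2.2 r hr).1, hNpos.ne'⟩
end

section
/- Let F_q be a finite field, G ≤ PGL_2(F_q) a subgroup, and let Q_G and Q_G' be two quotient maps for G. Then d(Q_G) = d(Q_G'); that is, the largest degree of a monic irreducible polynomial F ∈ F_q[x] whose transform F^{Q_G} is not squarefree (taken to be 0 if no such F exists) does not depend on the choice of quotient map for G. -/
open Polynomial

theorem aux_scalar {F : Type*} [Field F] (A B : GL (Fin 2) F)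
    (h1 : A.val 0 0 * B.val 1 0 = B.val 0 0 * A.val 1 0)
    (h2 : A.val 0 1 * B.val 1 1 = B.val 0 1 * A.val 1 1)
    (h3 : A.val 0 0 * B.val 1 1 + A.val 0 1 * B.val 1 0
      = B.val 0 0 * A.val 1 1 + B.val 0 1 * A.val 1 0) :
    PGL2.mk A = PGL2.mk B := by
  rw [QuotientGroup.eq, Matrix.GeneralLinearGroup.center_eq_range_scalar]
  have hdet : A.val.det ≠ 0 := by
    have := A.det.ne_zero
    simpa using this
  have hdetB : B.val.det ≠ 0 := by
    have := B.det.ne_zero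
    simpa using this
  rw [Matrix.det_fin_two] at hdet hdetB
  set D := A.val 0 0 * A.val 1 1 - A.val 0 1 * A.val 1 0 with hD
  set u := B.val 0 0 * A.val 1 1 - A.val 0 1 * B.val 1 0 with hu
  have e00 : D * B.val 0 0 = u * A.val 0 0 := by
    rw [hD, hu]; linear_combination (A.val 0 1) * h1
  have e01 : D * B.val 0 1 = u * A.val 0 1 := by
    rw [hD, hu]; linear_combination (-A.val 0 0) * h2 + A.val 0 1 * h3
  have e10 : D * B.val 1 0 = u * A.val 1 0 := by
    rw [hD, hu]; linear_combination (A.val 1 1) * h1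
  have e11 : D * B.val 1 1 = u * A.val 1 1 := by
    rw [hD, hu]; linear_combination (-A.val 1 0) * h2 + A.val 1 1 * h3
  have hu0 : u ≠ 0 := by
    intro h0
    rw [h0] at e00 e01
    apply hdetB
    have a : B.val 0 0 = 0 := by simpa [hdet] using e00
    have b : B.val 0 1 = 0 := by simpa [hdet] using e01
    rw [a, b]; ring
  refine ⟨Units.mk0 (u / D) (div_ne_zero hu0 hdet), ?_⟩
  rw [eq_inv_mul_iff_mul_eq]
  ext i j
  have hs : ∀ i j, (A.val * (Matrix.scalar (Fin 2) (u / D))) i j = A.val i j * (u / D) := by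
    intro i j
    simp [Matrix.scalar_apply, Matrix.mul_diagonal]
  have : (A * Matrix.GeneralLinearGroup.scalar (Fin 2) (Units.mk0 (u / D) (div_ne_zero hu0 hdet))).val i j
      = A.val i j * (u / D) := hs i j
  rw [this]
  rw [mul_div_assoc', div_eq_iff hdet]
  fin_cases i <;> fin_cases j <;> simp only [Fin.zero_eta, Fin.mk_one, Fin.isValue] <;>
    first
    | linear_combination -e00
    | linear_combination -e01
    | linear_combination -e10
    | linear_combination -e11

theorem aux_den {F : Type*} [Field F] (A : GL (Fin 2) F) :
    (C (A.val 1 0) * X + C (A.val 1 1) : F[X]) ≠ 0 := by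
  intro h
  have hdet : A.val.det ≠ 0 := by
    have := A.det.ne_zero
    simpa using this
  rw [Matrix.det_fin_two] at hdet
  have h0 := congrArg (fun p : F[X] => p.coeff 0) h
  have h1 := congrArg (fun p : F[X] => p.coeff 1) h
  simp at h0
  simp [coeff_C] at h1
  apply hdet
  rw [h0, h1]; ring

theorem aux_mobius {F : Type*} [Field F] (A : GL (Fin 2) F) :
    mobiusRatFunc A = algebraMap F[X] (RatFunc F) (C (A.val 0 0) * X + C (A.val 0 1)) /
      algebraMap F[X] (RatFunc F) (C (A.val 1 0) * X + C (A.val 1 1)) := by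
  simp [mobiusRatFunc, RatFunc.algebraMap_C, RatFunc.algebraMap_X]

theorem aux_inj {F : Type*} [Field F] (A B : GL (Fin 2) F)
    (h : mobiusRatFunc A = mobiusRatFunc B) : PGL2.mk A = PGL2.mk B := by
  rw [aux_mobius, aux_mobius, div_eq_div_iff
    (RatFunc.algebraMap_ne_zero (aux_den A)) (RatFunc.algebraMap_ne_zero (aux_den B)),
    ← map_mul, ← map_mul] at h
  have h := RatFunc.algebraMap_injective F h
  have key : ∀ a b c d : F, (C a * X + C b) * (C c * X + C d) =
      C (a * c) * X ^ 2 + C (a * d + b * c) * X + C (b * d) := by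
    intro a b c d
    simp only [map_mul, map_add]; ring
  rw [key, key] at h
  have h0 := congrArg (fun p : F[X] => p.coeff 0) h
  have h1 := congrArg (fun p : F[X] => p.coeff 1) h
  have h2 := congrArg (fun p : F[X] => p.coeff 2) h
  simp [coeff_C, coeff_X, coeff_X_pow, -map_add, -map_mul] at h0 h1 h2
  exact aux_scalar A B h2 h0 h1

theorem aux_root {F : Type*} [Field F] {G : Subgroup (PGL2 F)} {g h : F[X]}
    (hQ : IsQuotientMap G g h) (A : GL (Fin 2) F) (hA : PGL2.mk A ∈ G) :
    aeval (mobiusRatFunc A) g = algebraMap F[X] (RatFunc F) g / algebraMap F[X] (RatFunc F) h *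
      aeval (mobiusRatFunc A) h := by
  obtain ⟨hm, -, h0, -, -, hinv⟩ := hQ
  have e := hinv A hA
  have hz : aeval (mobiusRatFunc A) h ≠ 0 := by
    intro hz
    rw [hz, div_zero] at e
    exact div_ne_zero (RatFunc.algebraMap_ne_zero hm.ne_zero) (RatFunc.algebraMap_ne_zero h0) e.symm
  rw [← e, div_mul_cancel₀ _ hz]

theorem aux_coeff {F : Type*} [Field F] {G : Subgroup (PGL2 F)} {g h g' h' : F[X]}
    (hQ : IsQuotientMap G g h) (hQ' : IsQuotientMap G g' h') (i : ℕ) :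
    algebraMap F (RatFunc F) (g.coeff i) -
      algebraMap F[X] (RatFunc F) g / algebraMap F[X] (RatFunc F) h *
        algebraMap F (RatFunc F) (h.coeff i) =
    algebraMap F (RatFunc F) (g'.coeff i) -
      algebraMap F[X] (RatFunc F) g' / algebraMap F[X] (RatFunc F) h' *
        algebraMap F (RatFunc F) (h'.coeff i) := by
  have hr := aux_root hQ
  have hr' := aux_root hQ'
  obtain ⟨hm, -, h0, hd, hc, -⟩ := hQ
  obtain ⟨hm', -, h0', hd', hc', -⟩ := hQ'
  set Q := algebraMap F[X] (RatFunc F) g / algebraMap F[X] (RatFunc F) h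
  set Q' := algebraMap F[X] (RatFunc F) g' / algebraMap F[X] (RatFunc F) h'
  have : Finite G := Nat.finite_of_card_ne_zero (by omega)
  have := Fintype.ofFinite G
  rw [Nat.card_eq_fintype_card] at hc hc'
  let φ := algebraMap F (RatFunc F)
  let P : (RatFunc F)[X] := (g - g').map φ - (C Q * h.map φ - C Q' * h'.map φ)
  have hP : P = 0 := by
    apply eq_zero_of_natDegree_lt_card_of_eval_eq_zero P
      (f := fun a : G => mobiusRatFunc (Quotient.out a.1))
    · intro a b hab
      have := aux_inj _ _ hab
      simp only [PGL2.mk, QuotientGroup.out_eq'] at this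
      exact Subtype.ext this
    · intro a
      have ha : PGL2.mk (Quotient.out a.1) ∈ G := by
        simp only [PGL2.mk, QuotientGroup.out_eq']
        exact a.2
      have e := hr _ ha
      have e' := hr' _ ha
      simp only [P, φ, eval_sub, eval_mul, eval_C, eval_map_algebraMap, map_sub]
      rw [e, e']; ring
    · have hgg : (g - g').natDegree < Fintype.card G := by
        by_cases hz : g - g' = 0
        · rw [hz, natDegree_zero]; omega
        · rw [natDegree_lt_iff_degree_lt hz, ← hc, ← degree_eq_natDegree hm.ne_zero]
          apply degree_sub_lt _ hm.ne_zero (by rw [hm.leadingCoeff, hm'.leadingCoeff])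
          rw [degree_eq_natDegree hm.ne_zero, degree_eq_natDegree hm'.ne_zero, hc, hc']
      refine lt_of_le_of_lt (natDegree_sub_le _ _) (max_lt ?_ ?_)
      · rwa [natDegree_map]
      · refine lt_of_le_of_lt (natDegree_sub_le _ _) (max_lt ?_ ?_)
        · refine lt_of_le_of_lt (natDegree_C_mul_le _ _) ?_
          rw [natDegree_map]; omega
        · refine lt_of_le_of_lt (natDegree_C_mul_le _ _) ?_
          rw [natDegree_map]; omega
  have := congrArg (fun p => p.coeff i) hP
  simp only [P, φ, coeff_sub, coeff_C_mul, coeff_map, coeff_zero, map_sub] at this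
  linear_combination this

/-- Two quotient maps differ by an affine map. -/
theorem aux_affine {F : Type*} [Field F] {G : Subgroup (PGL2 F)} {g h g' h' : F[X]}
    (hQ : IsQuotientMap G g h) (hQ' : IsQuotientMap G g' h') :
    ∃ α β : F, β ≠ 0 ∧ algebraMap F[X] (RatFunc F) g / algebraMap F[X] (RatFunc F) h =
      algebraMap F (RatFunc F) α + algebraMap F (RatFunc F) β *
        (algebraMap F[X] (RatFunc F) g' / algebraMap F[X] (RatFunc F) h') ∧ h' = C β * h := by
  have hco := aux_coeff hQ hQ'
  obtain ⟨hm, -, h0, hd, hc, -⟩ := hQ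
  obtain ⟨hm', -, h0', hd', hc', -⟩ := hQ'
  set Q := algebraMap F[X] (RatFunc F) g / algebraMap F[X] (RatFunc F) h
  set Q' := algebraMap F[X] (RatFunc F) g' / algebraMap F[X] (RatFunc F) h' with hQ'
  have hl : h.leadingCoeff ≠ 0 := leadingCoeff_ne_zero.mpr h0
  have hl' : algebraMap F (RatFunc F) h.leadingCoeff ≠ 0 := by simpa using hl
  have e := hco h.natDegree
  rw [coeff_natDegree] at e
  have hlin : ∀ a b : F, algebraMap F (RatFunc F) a = algebraMap F (RatFunc F) b * Q' → b = 0 := by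
    intro a b hab
    by_contra hb
    have hh : algebraMap F[X] (RatFunc F) h' ≠ 0 := RatFunc.algebraMap_ne_zero h0'
    rw [hQ', mul_div_assoc', eq_div_iff hh, IsScalarTower.algebraMap_apply F F[X] (RatFunc F),
      IsScalarTower.algebraMap_apply F F[X] (RatFunc F), ← map_mul, ← map_mul] at hab
    have hab := RatFunc.algebraMap_injective F hab
    rw [algebraMap_eq] at hab
    have h1 := natDegree_C_mul_le a h'
    rw [hab, natDegree_C_mul hb] at h1
    omega
  let α := (g.coeff h.natDegree - g'.coeff h.natDegree) / h.leadingCoeff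
  let β := h'.coeff h.natDegree / h.leadingCoeff
  have haff : Q = algebraMap F (RatFunc F) α + algebraMap F (RatFunc F) β * Q' := by
    simp only [α, β, map_div₀, map_sub]
    field_simp
    linear_combination -e
  have hh' : h' = C β * h := by
    ext i
    rw [coeff_C_mul]
    have ei := hco i
    rw [haff] at ei
    have := hlin (g.coeff i - g'.coeff i - α * h.coeff i) (β * h.coeff i - h'.coeff i) (by
      simp only [map_sub, map_mul]
      linear_combination ei)
    exact (sub_eq_zero.mp this).symm
  refine ⟨α, β, ?_, haff, hh'⟩
  intro hb
  apply h0'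
  rw [hh', hb]; simp

theorem aux_transform {F : Type*} [Field F] (g h f : F[X]) (h0 : h ≠ 0) :
    algebraMap F[X] (RatFunc F) (ratTransform g h f) =
      algebraMap F[X] (RatFunc F) h ^ f.natDegree *
        aeval (algebraMap F[X] (RatFunc F) g / algebraMap F[X] (RatFunc F) h) f := by
  have hh : algebraMap F[X] (RatFunc F) h ≠ 0 := RatFunc.algebraMap_ne_zero h0
  rw [aeval_eq_sum_range, ratTransform, map_sum, Finset.mul_sum]
  refine Finset.sum_congr rfl fun i hi => ?_
  have hi : i ≤ f.natDegree := by simpa [Nat.lt_succ_iff] using hi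
  obtain ⟨k, hk⟩ := Nat.exists_eq_add_of_le hi
  rw [Algebra.smul_def, IsScalarTower.algebraMap_apply F F[X] (RatFunc F), algebraMap_eq,
    map_mul, map_mul, map_pow, map_pow, hk, Nat.add_sub_cancel_left, pow_add, div_pow]
  field_simp

theorem aux_subset {F : Type*} [Field F] {G : Subgroup (PGL2 F)} {g h g' h' : F[X]}
    (hQ : IsQuotientMap G g h) (hQ' : IsQuotientMap G g' h') :
    {n : ℕ | ∃ f : F[X], f.Monic ∧ Irreducible f ∧ f.natDegree = n ∧
      ¬ Squarefree (ratTransform g h f)} ⊆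
    {n : ℕ | ∃ f : F[X], f.Monic ∧ Irreducible f ∧ f.natDegree = n ∧
      ¬ Squarefree (ratTransform g' h' f)} := by
  rintro n ⟨f, hfm, hfi, hfn, hsq⟩
  obtain ⟨α, β, hβ, haff, hh'⟩ := aux_affine hQ hQ'
  have h0 := hQ.2.2.1
  have h0' := hQ'.2.2.1
  have hβn : (β ^ n)⁻¹ ≠ 0 := inv_ne_zero (pow_ne_zero _ hβ)
  let f1 : F[X] := f.comp (C β * X + C α)
  let f2 : F[X] := C (β ^ n)⁻¹ * f1
  have hlin : (C β * X + C α : F[X]).natDegree = 1 := natDegree_linear hβ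
  have hd1 : f1.natDegree = n := by simp only [f1]; rw [natDegree_comp, hlin, mul_one, hfn]
  have hd2 : f2.natDegree = n := by simp only [f2]; rw [natDegree_C_mul hβn, hd1]
  have hl1 : f1.leadingCoeff = β ^ n := by
    simp only [f1]
    rw [leadingCoeff_comp (by rw [hlin]; exact one_ne_zero), hfm.leadingCoeff, one_mul, hfn,
      leadingCoeff_linear hβ]
  have hi1 : Irreducible f1 := by
    letI := invertibleOfNonzero hβ
    have := (MulEquiv.irreducible_iff (algEquivCMulXAddC β α) (x := f)).mpr hfi
    simpa [f1, comp_eq_aeval] using this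
  refine ⟨f2, ?_, ?_, hd2, ?_⟩
  · rw [Monic, leadingCoeff_mul, leadingCoeff_C, hl1, inv_mul_cancel₀ (pow_ne_zero _ hβ)]
  · exact (irreducible_isUnit_mul (isUnit_C.mpr hβn.isUnit)).mpr hi1
  · have : ratTransform g' h' f2 = ratTransform g h f := by
      apply RatFunc.algebraMap_injective F
      rw [aux_transform _ _ _ h0, aux_transform _ _ _ h0', hd2, hfn, haff]
      have hb : algebraMap F (RatFunc F) β ≠ 0 := by simpa using hβ
      simp only [f2, f1, map_mul, aeval_comp, aeval_C, map_add, aeval_X, map_inv₀, map_pow]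
      rw [add_comm (algebraMap F (RatFunc F) α)]
      have hhh : algebraMap F[X] (RatFunc F) h' =
          algebraMap F (RatFunc F) β * algebraMap F[X] (RatFunc F) h := by
        rw [IsScalarTower.algebraMap_apply F F[X] (RatFunc F), ← map_mul, algebraMap_eq, ← hh']
      generalize (aeval (_ : RatFunc F) f : RatFunc F) = Z
      rw [hhh, mul_pow]
      field_simp
    rwa [this]

theorem dval_independent_of_quotient_map (F : Type*) [Field F] [Fintype F]
    (G : Subgroup (PGL2 F)) (g h g' h' : F[X])
    (hQ : IsQuotientMap G g h) (hQ' : IsQuotientMap G g' h') :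
    dval g h = dval g' h' := by
  exact congrArg sSup (Set.Subset.antisymm (aux_subset hQ hQ') (aux_subset hQ' hQ))
end
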